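/- Let k ∈ ℂ with Re(k) > 0 and δ > 0. Let f : ℚ → ℂ satisfy weak periodicity (f(x+1) = f(x) for all x ∈ ℚ\[−1,0]) and the reciprocity relation f(x) − |x|^{−k}·f(−1/x) = h(x) for all x ∈ ℚ\{0}, where |h(x)| ≤ C·exp(|x|^{−1+δ}) for all x ∈ (−1,1)\{0}. Let f‡ be the Lebesgue-measurable function defined on a full-measure set X ⊆ ℝ by f‡(x) := lim_{j→∞} den(x_{2j+1})^{−k}·f( (x_{2j+1})‾ ) along the odd-index continued-fraction convergents of x. Then for every bounded continuous function G : ℂ → ℝ, (1/φ(q))·Σ_{a=1, gcd(a,q)=1}^{q} G(q^{−k}·f(a/q)) → ∫_{[0,1]} G(f‡(x)) dx as q → ∞, where φ is Euler's totient function. Equivalently, the multisets {q^{−k} f(a/q) : 1 ≤ a ≤ q, gcd(a,q)=1} become distributed, as q → ∞, according to the pushforward of Lebesgue measure on [0,1] under f‡. -/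

import Mathlib

open Filter Topology MeasureTheory Set

/-- Partial quotients of the regular continued fraction expansion of `x`
(with the convention that `cfb j x = 0` for `j` beyond the length of the expansion). -/
noncomputable def cfb : ℕ → ℝ → ℤ
  | 0, x => ⌊x⌋
  | n + 1, x => cfb n (Int.fract x)⁻¹

/-- Numerators and denominators of the continued fraction convergents of `x`. -/
noncomputable def cfPQ (x : ℝ) : ℕ → ℤ × ℤ
  | 0 => (cfb 0 x, 1)
  | 1 => (cfb 1 x * cfb 0 x + 1, cfb 1 x)
  | n + 2 => (cfb (n + 2) x * (cfPQ x (n + 1)).1 + (cfPQ x n).1,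
              cfb (n + 2) x * (cfPQ x (n + 1)).2 + (cfPQ x n).2)

/-- The `n`-th continued fraction convergent of `x`, as a rational number. -/
noncomputable def cfConv (x : ℝ) (n : ℕ) : ℚ := ((cfPQ x n).1 : ℚ) / ((cfPQ x n).2 : ℚ)

/-- For a rational `y = a/q` in lowest terms, `ratBar y = ā/q` where `ā ∈ {1,…,q}` is
the multiplicative inverse of `a` modulo `q` (and `ā = 1` when `q = 1`). -/
def ratBar (y : ℚ) : ℚ :=
  (if ((y.num : ZMod y.den)⁻¹).val = 0 then (y.den : ℚ)
   else (((y.num : ZMod y.den)⁻¹).val : ℚ)) / (y.den : ℚ)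

theorem sum_divisors_moebius_gcd (q b : ℕ) (hq : 0 < q) :
    (∑ d ∈ q.divisors, if d ∣ b then (ArithmeticFunction.moebius d : ℝ) else 0) =
      if b.Coprime q then 1 else 0 := by
  have h1 : q.divisors.filter (· ∣ b) = (b.gcd q).divisors := by
    ext d
    simp only [Finset.mem_filter, Nat.mem_divisors, Nat.dvd_gcd_iff]
    have : b.gcd q ≠ 0 := (Nat.gcd_pos_of_pos_right b hq).ne'
    have := hq.ne'
    tauto
  rw [← Finset.sum_filter, h1, ← Int.cast_sum, ← ArithmeticFunction.coe_mul_zeta_apply,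
    ArithmeticFunction.moebius_mul_coe_zeta, ArithmeticFunction.one_apply]
  simp [Nat.Coprime]

theorem card_coprime_Ioc_zero (q y : ℕ) (hq : 0 < q) :
    (((Finset.Ioc 0 y).filter fun b => b.Coprime q).card : ℝ) =
      ∑ d ∈ q.divisors, (ArithmeticFunction.moebius d : ℝ) * ((y / d : ℕ) : ℝ) := by
  rw [Finset.card_filter]
  push_cast
  simp_rw [← sum_divisors_moebius_gcd q _ hq]
  rw [Finset.sum_comm]
  refine Finset.sum_congr rfl fun d _ => ?_
  rw [← Finset.sum_filter, Finset.sum_const, Nat.Ioc_filter_dvd_card_eq_div, nsmul_eq_mul, mul_comm]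

theorem card_coprime_Ioc_self (q : ℕ) :
    ((Finset.Ioc 0 q).filter fun b => b.Coprime q).card = q.totient := by
  rw [← Nat.filter_coprime_Ico_eq_totient q 1]
  congr 1
  ext b
  simp [Nat.coprime_comm]
  omega

/-- The number of integers in `(x, y]` that are coprime to `q` is `(y - x) φ(q) / q` up to an
error of at most the number of divisors of `q`. -/
theorem abs_card_coprime_Ioc_sub_le (q x y : ℕ) (hq : 0 < q) (hxy : x ≤ y) :
    |(((Finset.Ioc x y).filter fun b => b.Coprime q).card : ℝ) -
      ((y : ℝ) - x) * (q.totient / q)| ≤ q.divisors.card := by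
  have hsplit : (((Finset.Ioc x y).filter fun b => b.Coprime q).card : ℝ) =
      ((Finset.Ioc 0 y).filter fun b => b.Coprime q).card -
        ((Finset.Ioc 0 x).filter fun b => b.Coprime q).card := by
    rw [← Finset.Ioc_union_Ioc_eq_Ioc (Nat.zero_le x) hxy, Finset.filter_union,
      Finset.card_union_of_disjoint]
    · push_cast; ring
    · refine Finset.disjoint_filter_filter ?_
      rw [Finset.disjoint_left]
      intro a
      simp only [Finset.mem_Ioc]
      omega
  have hφ : (q.totient : ℝ) / q =
      ∑ d ∈ q.divisors, (ArithmeticFunction.moebius d : ℝ) * (1 / d) := by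
    rw [← card_coprime_Ioc_self, card_coprime_Ioc_zero _ _ hq, Finset.sum_div]
    refine Finset.sum_congr rfl fun d hd => ?_
    have hd' := Nat.dvd_of_mem_divisors hd
    have : (d : ℝ) ≠ 0 := by
      have := Nat.pos_of_mem_divisors hd
      positivity
    rw [Nat.cast_div hd' this]
    field_simp
  rw [hsplit, card_coprime_Ioc_zero _ _ hq, card_coprime_Ioc_zero _ _ hq, hφ, Finset.mul_sum,
    ← Finset.sum_sub_distrib, ← Finset.sum_sub_distrib]
  refine (Finset.abs_sum_le_sum_abs _ _).trans ?_
  rw [Finset.cast_card]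
  refine Finset.sum_le_sum fun d hd => ?_
  have hd0 : (0 : ℝ) < d := by exact_mod_cast Nat.pos_of_mem_divisors hd
  have key : ∀ n : ℕ, ((n / d : ℕ) : ℝ) ≤ n / d ∧ (n : ℝ) / d < (n / d : ℕ) + 1 := by
    intro n
    exact ⟨Nat.cast_div_le, by
      rw [← Nat.floor_div_eq_div (K := ℝ)]; exact Nat.lt_floor_add_one _⟩
  have hμ : |(ArithmeticFunction.moebius d : ℝ)| ≤ 1 := by
    exact_mod_cast ArithmeticFunction.abs_moebius_le_one (n := d)
  have hrw : (ArithmeticFunction.moebius d : ℝ) * ((y / d : ℕ) : ℝ) -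
      (ArithmeticFunction.moebius d : ℝ) * ((x / d : ℕ) : ℝ) -
      ((y : ℝ) - x) * ((ArithmeticFunction.moebius d : ℝ) * (1 / d)) =
      (ArithmeticFunction.moebius d : ℝ) *
        ((((y / d : ℕ) : ℝ) - y / d) - (((x / d : ℕ) : ℝ) - x / d)) := by
    ring
  rw [hrw, abs_mul]
  have hy := key y
  have hx := key x
  have : |(((y / d : ℕ) : ℝ) - y / d) - (((x / d : ℕ) : ℝ) - x / d)| ≤ 1 := by
    rw [abs_le]
    constructor <;> linarith [hx.1, hx.2, hy.1, hy.2]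
  calc _ ≤ (1 : ℝ) * 1 := mul_le_mul hμ this (abs_nonneg _) zero_le_one
    _ = 1 := one_mul 1

theorem card_divisors_le_two_mul_sqrt (q : ℕ) : q.divisors.card ≤ 2 * q.sqrt := by
  have hsub : q.divisors ⊆ Finset.Icc 1 q.sqrt ∪ (Finset.Icc 1 q.sqrt).image (q / ·) := by
    intro d hd
    have hpos := Nat.pos_of_mem_divisors hd
    obtain ⟨⟨e, rfl⟩, hq⟩ := Nat.mem_divisors.1 hd
    simp only [Finset.mem_union, Finset.mem_Icc, Finset.mem_image]
    have he : 0 < e := Nat.pos_of_ne_zero (by rintro rfl; simp at hq)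
    rcases le_total d e with h | h
    · exact Or.inl ⟨hpos, Nat.le_sqrt.2 (Nat.mul_le_mul_left d h)⟩
    · exact Or.inr ⟨e, ⟨he, Nat.le_sqrt.2 (Nat.mul_le_mul_right e h)⟩, Nat.mul_div_cancel _ he⟩
  calc q.divisors.card ≤ _ := Finset.card_le_card hsub
    _ ≤ _ := Finset.card_union_le _ _
    _ ≤ q.sqrt + q.sqrt := by
      gcongr
      · simp
      · exact Finset.card_image_le.trans (by simp)
    _ = _ := by ring


theorem card_primes_dyadic_mul_le (i : ℕ) :
    ((Finset.Ico (2 ^ i) (2 ^ (i + 1))).filter Nat.Prime).card * i ≤ 4 * 2 ^ i := by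
  set s := (Finset.Ico (2 ^ i) (2 ^ (i + 1))).filter Nat.Prime with hs
  have h1 : (2 ^ i) ^ s.card ≤ ∏ p ∈ s, p :=
    Finset.pow_card_le_prod s (fun p => p) (2 ^ i) fun p hp => by
      simp only [hs, Finset.mem_filter, Finset.mem_Ico] at hp
      exact hp.1.1
  have h2 : ∏ p ∈ s, p ≤ primorial (2 ^ (i + 1)) := by
    refine Finset.prod_le_prod_of_subset_of_one_le' ?_ ?_
    · intro p hp
      simp only [hs, Finset.mem_filter, Finset.mem_Ico] at hp
      simp [hp.2]
      omega
    · intro p hp _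
      exact (Finset.mem_filter.1 hp).2.one_lt.le
  have h3 := (h1.trans h2).trans (primorial_le_four_pow _)
  rw [← pow_mul, show (4 : ℕ) = 2 ^ 2 by norm_num, ← pow_mul] at h3
  have h4 := (Nat.pow_le_pow_iff_right (by norm_num)).1 h3
  rw [pow_succ] at h4
  linarith

theorem sum_inv_primes_lt_two_pow_le (n : ℕ) :
    ∑ p ∈ (Finset.range (2 ^ (n + 1))).filter Nat.Prime, (1 : ℝ) / p ≤
      4 * (harmonic n : ℝ) := by
  induction n with
  | zero =>
    have : (Finset.range (2 ^ (0 + 1))).filter Nat.Prime = ∅ := by decide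
    rw [this]; simp
  | succ n ih =>
    have hsplit : (Finset.range (2 ^ (n + 1 + 1))).filter Nat.Prime =
        (Finset.range (2 ^ (n + 1))).filter Nat.Prime ∪
          (Finset.Ico (2 ^ (n + 1)) (2 ^ (n + 1 + 1))).filter Nat.Prime := by
      rw [← Finset.filter_union, Finset.range_eq_Ico, Finset.range_eq_Ico,
        Finset.Ico_union_Ico_eq_Ico (Nat.zero_le _) (Nat.pow_le_pow_right two_pos (by omega))]
    have hblock : ∑ p ∈ (Finset.Ico (2 ^ (n + 1)) (2 ^ (n + 1 + 1))).filter Nat.Prime,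
        (1 : ℝ) / p ≤ 4 / (n + 1) := by
      have h1 : ∀ p ∈ (Finset.Ico (2 ^ (n + 1)) (2 ^ (n + 1 + 1))).filter Nat.Prime,
          (1 : ℝ) / p ≤ 1 / 2 ^ (n + 1) := by
        intro p hp
        simp only [Finset.mem_filter, Finset.mem_Ico] at hp
        have : (2 : ℝ) ^ (n + 1) ≤ p := by exact_mod_cast hp.1.1
        exact one_div_le_one_div_of_le (by positivity) this
      refine (Finset.sum_le_card_nsmul _ _ _ h1).trans ?_
      have h2 : ((((Finset.Ico (2 ^ (n + 1)) (2 ^ (n + 1 + 1))).filter Nat.Prime).card : ℕ) : ℝ) *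
          ((n : ℝ) + 1) ≤ 4 * 2 ^ (n + 1) := by
        exact_mod_cast card_primes_dyadic_mul_le (n + 1)
      rw [nsmul_eq_mul, mul_one_div, div_le_div_iff₀ (by positivity) (by positivity)]
      exact h2
    have hdisj : Disjoint ((Finset.range (2 ^ (n + 1))).filter Nat.Prime)
        ((Finset.Ico (2 ^ (n + 1)) (2 ^ (n + 1 + 1))).filter Nat.Prime) := by
      refine Finset.disjoint_filter_filter ?_
      rw [Finset.range_eq_Ico]
      exact Finset.Ico_disjoint_Ico_consecutive _ _ _
    rw [hsplit, Finset.sum_union hdisj, harmonic_succ]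
    push_cast
    have : (4 : ℝ) / (n + 1) = 4 * ((n : ℝ) + 1)⁻¹ := by ring
    linarith

theorem two_pow_card_primeFactors_le (q : ℕ) (hq : 0 < q) : 2 ^ q.primeFactors.card ≤ q := by
  have h1 : 2 ^ q.primeFactors.card ≤ ∏ p ∈ q.primeFactors, p :=
    Finset.pow_card_le_prod _ (fun p => p) 2 fun p hp => (Nat.prime_of_mem_primeFactors hp).two_le
  exact h1.trans (Nat.le_of_dvd hq (Nat.prod_primeFactors_dvd q))

theorem self_le_totient_mul_exp (q n : ℕ) (hq : 0 < q) (hn : q < 2 ^ 2 ^ (n + 1)) :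
    (q : ℝ) ≤ q.totient * Real.exp (8 * (harmonic n : ℝ) + 2) := by
  have hprod : (q : ℝ) = q.totient * ∏ p ∈ q.primeFactors, ((p : ℝ) / (p - 1)) := by
    have h := congrArg (fun m : ℕ => (m : ℝ)) (Nat.totient_mul_prod_primeFactors q)
    push_cast at h
    have h2 : (∏ p ∈ q.primeFactors, ((p - 1 : ℕ) : ℝ)) = ∏ p ∈ q.primeFactors, ((p : ℝ) - 1) := by
      refine Finset.prod_congr rfl fun p hp => ?_
      rw [Nat.cast_pred (Nat.prime_of_mem_primeFactors hp).pos]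
    rw [h2] at h
    have h3 : ∏ p ∈ q.primeFactors, ((p : ℝ) - 1) ≠ 0 := by
      refine Finset.prod_ne_zero_iff.2 fun p hp => ?_
      have : (2 : ℝ) ≤ p := by exact_mod_cast (Nat.prime_of_mem_primeFactors hp).two_le
      intro h; linarith
    rw [Finset.prod_div_distrib, ← mul_div_assoc, h, mul_div_assoc, div_self h3, mul_one]
  have hexp : ∏ p ∈ q.primeFactors, ((p : ℝ) / (p - 1)) ≤
      Real.exp (2 * ∑ p ∈ q.primeFactors, (1 : ℝ) / p) := by
    rw [Finset.mul_sum, Real.exp_sum]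
    refine Finset.prod_le_prod ?_ ?_
    · intro p hp
      have : (2 : ℝ) ≤ p := by exact_mod_cast (Nat.prime_of_mem_primeFactors hp).two_le
      have : (0 : ℝ) < p - 1 := by linarith
      positivity
    · intro p hp
      have h2 : (2 : ℝ) ≤ p := by exact_mod_cast (Nat.prime_of_mem_primeFactors hp).two_le
      refine le_trans ?_ (Real.add_one_le_exp _)
      rw [div_le_iff₀ (by linarith)]
      have : (2 * (1 / (p : ℝ)) + 1) * (p - 1) = p + 1 - 2 / p := by field_simp; ring
      rw [this]
      have : (2 : ℝ) / p ≤ 1 := by rw [div_le_one (by linarith)]; exact h2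
      linarith
  have hsum : ∑ p ∈ q.primeFactors, (1 : ℝ) / p ≤ 4 * (harmonic n : ℝ) + 1 := by
    rw [← Finset.sum_filter_add_sum_filter_not q.primeFactors (· < 2 ^ (n + 1))]
    refine add_le_add (le_trans ?_ (sum_inv_primes_lt_two_pow_le n)) ?_
    · refine Finset.sum_le_sum_of_subset_of_nonneg ?_ fun _ _ _ => by positivity
      intro p hp
      simp only [Finset.mem_filter, Finset.mem_range] at hp ⊢
      exact ⟨hp.2, Nat.prime_of_mem_primeFactors hp.1⟩
    · have h1 : ∀ p ∈ q.primeFactors.filter (¬ · < 2 ^ (n + 1)), (1 : ℝ) / p ≤ 1 / 2 ^ (n + 1) := by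
        intro p hp
        simp only [Finset.mem_filter, not_lt] at hp
        have : (2 : ℝ) ^ (n + 1) ≤ p := by exact_mod_cast hp.2
        exact one_div_le_one_div_of_le (by positivity) this
      refine (Finset.sum_le_card_nsmul _ _ _ h1).trans ?_
      have h2 : (q.primeFactors.filter (¬ · < 2 ^ (n + 1))).card ≤ 2 ^ (n + 1) := by
        refine (Finset.card_filter_le _ _).trans ?_
        have := (two_pow_card_primeFactors_le q hq).trans_lt hn
        exact ((Nat.pow_lt_pow_iff_right (by norm_num)).1 this).le
      have h3 : ((q.primeFactors.filter (¬ · < 2 ^ (n + 1))).card : ℝ) ≤ 2 ^ (n + 1) := by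
        exact_mod_cast h2
      rw [nsmul_eq_mul, mul_one_div, div_le_one (by positivity)]
      exact h3
  calc (q : ℝ) = _ := hprod
    _ ≤ q.totient * Real.exp (2 * ∑ p ∈ q.primeFactors, (1 : ℝ) / p) := by gcongr
    _ ≤ _ := by
      gcongr
      linarith

/-- `q / φ(q)` grows more slowly than every positive power of `log q`. -/
theorem eventually_self_le_totient_mul_log_rpow (ε : ℝ) (hε : 0 < ε) :
    ∀ᶠ q : ℕ in atTop, (q : ℝ) ≤ q.totient * Real.log q ^ ε := by
  have hlog : Tendsto (fun q : ℕ => Real.log q) atTop atTop :=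
    Real.tendsto_log_atTop.comp tendsto_natCast_atTop_atTop
  have hmain : ∀ᶠ l : ℝ in atTop, Real.exp 10 * (4 * Real.log l) ^ 8 ≤ l ^ ε := by
    have h := (isLittleO_log_rpow_rpow_atTop 8 hε).bound
      (c := (Real.exp 10 * 4 ^ 8)⁻¹) (by positivity)
    filter_upwards [h, eventually_ge_atTop 1] with l hl hl1
    have h0 : 0 ≤ Real.log l := Real.log_nonneg hl1
    rw [Real.norm_of_nonneg (by positivity), Real.norm_of_nonneg (by positivity),
      ← div_eq_inv_mul, le_div_iff₀ (by positivity)] at hl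
    norm_num at hl
    rw [mul_pow]
    linarith
  have h2 := hlog.eventually hmain
  have h3 := hlog.eventually (eventually_ge_atTop (16 : ℝ))
  filter_upwards [h2, h3, eventually_ge_atTop 2] with q hq hq16 hq2
  set n := Nat.log 2 (Nat.log 2 q + 1) with hn
  have hlt : q < 2 ^ 2 ^ (n + 1) := by
    have h4 : q < 2 ^ (Nat.log 2 q + 1) := Nat.lt_pow_succ_log_self (by norm_num) q
    have h5 : Nat.log 2 q + 1 < 2 ^ (n + 1) := Nat.lt_pow_succ_log_self (by norm_num) _
    exact h4.trans (Nat.pow_lt_pow_right (by norm_num) h5)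
  refine (self_le_totient_mul_exp q n (by omega) hlt).trans ?_
  gcongr
  refine le_trans ?_ hq
  have hlog2 := Real.log_two_gt_d9
  have hl2 : (Nat.log 2 q : ℝ) ≤ 2 * Real.log q := by
    have : ((2 : ℝ) ^ (Nat.log 2 q)) ≤ q := by
      exact_mod_cast Nat.pow_log_le_self 2 (by omega : q ≠ 0)
    have := Real.log_le_log (by positivity) this
    rw [Real.log_pow] at this
    nlinarith [Nat.cast_nonneg (α := ℝ) (Nat.log 2 q)]
  have hn2 : (n : ℝ) ≤ 4 * Real.log (Real.log q) - 1 := by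
    have h4 : ((2 : ℝ) ^ n) ≤ Nat.log 2 q + 1 := by
      exact_mod_cast Nat.pow_log_le_self 2 (by omega : Nat.log 2 q + 1 ≠ 0)
    have h5 : (2 : ℝ) ^ n ≤ 4 * Real.log q := by linarith
    have h6 := Real.log_le_log (by positivity) h5
    rw [Real.log_pow, Real.log_mul (by norm_num) (by linarith),
      show (4 : ℝ) = 2 ^ 2 by norm_num, Real.log_pow] at h6
    have h7 : 4 * Real.log 2 ≤ Real.log (Real.log q) := by
      have := Real.log_le_log (by norm_num) hq16
      rwa [show (16 : ℝ) = 2 ^ 4 by norm_num, Real.log_pow] at this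
    push_cast at h6 h7
    nlinarith [Nat.cast_nonneg (α := ℝ) n]
  have hharm := harmonic_le_one_add_log n
  have hl4 : Real.log n ≤ Real.log (4 * Real.log (Real.log q)) := by
    rcases Nat.eq_zero_or_pos n with h0 | h0
    · rw [h0, Nat.cast_zero, Real.log_zero]
      refine Real.log_nonneg ?_
      have := Nat.cast_nonneg (α := ℝ) n
      linarith
    · exact Real.log_le_log (by exact_mod_cast h0) (by linarith)
  have hpos : 0 < 4 * Real.log (Real.log q) := by
    have := Nat.cast_nonneg (α := ℝ) n
    linarith
  calc Real.exp (8 * (harmonic n : ℝ) + 2)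
      ≤ Real.exp (10 + 8 * Real.log (4 * Real.log (Real.log q))) := by
        exact Real.exp_le_exp.2 (by linarith)
    _ = _ := by
        rw [Real.exp_add]
        congr 1
        rw [show (8 : ℝ) * Real.log (4 * Real.log (Real.log q)) =
          ((8 : ℕ) : ℝ) * Real.log (4 * Real.log (Real.log q)) by norm_num, Real.exp_nat_mul,
          Real.exp_log hpos]

open scoped Classical in
/-- The integers `1 ≤ b ≤ q` with `b` coprime to `q` such that the distance from `v b` to
`q ℤ` is at most `R`. -/
noncomputable def nearMultiples (q v : ℕ) (R : ℝ) : Finset ℕ :=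
  ((Finset.Icc 1 q).filter fun a => Nat.Coprime a q).filter
    fun b => ∃ u : ℤ, |(v : ℝ) * b - u * q| ≤ R

theorem mem_nearMultiples {q v : ℕ} {R : ℝ} {b : ℕ} :
    b ∈ nearMultiples q v R ↔
      ((1 ≤ b ∧ b ≤ q) ∧ b.Coprime q) ∧ ∃ u : ℤ, |(v : ℝ) * b - u * q| ≤ R := by
  simp [nearMultiples]

theorem card_nearMultiples_le_of_lt (q v : ℕ) (R : ℝ) (hv : 0 < v) (hvq : v < q) (hR : 0 ≤ R) :
    ((nearMultiples q v R).card : ℝ) ≤ 2 * R := by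
  set g := v.gcd q with hg
  have hg0 : 0 < g := Nat.gcd_pos_of_pos_left _ hv
  obtain ⟨v', hv'⟩ : g ∣ v := Nat.gcd_dvd_left _ _
  obtain ⟨q', hq'⟩ : g ∣ q := Nat.gcd_dvd_right _ _
  have hcop : Nat.Coprime v' q' := by
    have := Nat.coprime_div_gcd_div_gcd (m := v) (n := q) hg0
    rwa [← hg, hv', hq', Nat.mul_div_cancel_left _ hg0, Nat.mul_div_cancel_left _ hg0] at this
  have hq'0 : 0 < q' := Nat.pos_of_ne_zero (by rintro rfl; omega)
  have hex : ∀ b : ℕ, ∃ u : ℤ, b ∈ nearMultiples q v R → |(v : ℝ) * b - u * q| ≤ R := by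
    intro b
    by_cases hb : b ∈ nearMultiples q v R
    · obtain ⟨u, hu⟩ := (mem_nearMultiples.1 hb).2
      exact ⟨u, fun _ => hu⟩
    · exact ⟨0, fun h => absurd h hb⟩
  choose u hu using hex
  set K := ⌊R / g⌋₊ with hK
  set t : Finset (ℤ × ℕ) := ((Finset.Icc (-(K : ℤ)) K).erase 0) ×ˢ Finset.range g with ht
  have hcard : t.card = 2 * K * g := by
    rw [ht, Finset.card_product, Finset.card_erase_of_mem (by simp), Int.card_Icc,
      Finset.card_range]
    congr 1
    omega
  have hle : (nearMultiples q v R).card ≤ t.card := by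
    refine Finset.card_le_card_of_injOn
      (fun b => ((v' : ℤ) * b - u b * q', (b - 1) / q')) ?_ ?_
    · intro b hb
      have hb1 := hu b hb
      obtain ⟨⟨hb2, hbc⟩, _⟩ := mem_nearMultiples.1 hb
      have hgR : (0 : ℝ) < g := by exact_mod_cast hg0
      simp only [ht, Finset.coe_product, Set.mem_prod, Finset.mem_coe, Finset.mem_erase,
        Finset.mem_Icc, Finset.mem_range]
      refine ⟨⟨?_, ?_⟩, ?_⟩
      · intro h0
        have h1 : (q' : ℤ) ∣ v' * b := ⟨u b, by linarith⟩
        have h2 : q' ∣ v' * b := by exact_mod_cast h1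
        have h3 : q' ∣ b := hcop.symm.dvd_of_dvd_mul_left h2
        have h4 : q' ∣ 1 := by
          rw [← Nat.Coprime.gcd_eq_one hbc]
          exact Nat.dvd_gcd h3 ⟨g, by rw [hq']; ring⟩
        have h5 : q' = 1 := Nat.dvd_one.1 h4
        have h6 : q ≤ v := by
          rw [hq', h5, mul_one]
          exact Nat.le_of_dvd hv ⟨v', hv'⟩
        omega
      · have h1 : |(((v' : ℤ) * b - u b * q' : ℤ) : ℝ)| ≤ R / g := by
          rw [le_div_iff₀ hgR, ← abs_of_pos hgR, ← abs_mul]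
          refine le_trans (le_of_eq ?_) hb1
          congr 1
          rw [hv', hq']
          push_cast
          ring
        have h2 : (((v' : ℤ) * b - u b * q' : ℤ).natAbs) ≤ K := by
          refine Nat.le_floor ?_
          rw [Nat.cast_natAbs]
          exact_mod_cast h1
        omega
      · rw [Nat.div_lt_iff_lt_mul hq'0, ← hq']
        omega
    · intro b hb b' hb' hbb
      simp only [Prod.mk.injEq] at hbb
      obtain ⟨h1, h2⟩ := hbb
      have hb2 := (mem_nearMultiples.1 hb).1.1
      have hb2' := (mem_nearMultiples.1 hb').1.1
      have h3 : (q' : ℤ) ∣ v' * ((b : ℤ) - b') := ⟨u b - u b', by linear_combination h1⟩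
      have h4 : (q' : ℤ) ∣ (b : ℤ) - b' := by
        have hc : IsCoprime (q' : ℤ) v' := Nat.isCoprime_iff_coprime.2 hcop.symm
        exact hc.dvd_of_dvd_mul_left h3
      have h5 : (b' - 1) ≡ (b - 1) [MOD q'] := by
        rw [Nat.modEq_iff_dvd, Nat.cast_sub hb2.1, Nat.cast_sub hb2'.1]
        simpa using h4
      have h6 : b - 1 = b' - 1 := by
        rw [← Nat.div_add_mod (b - 1) q', ← Nat.div_add_mod (b' - 1) q', h2]
        congr 1
        exact h5.symm
      omega
  have hKR : (K : ℝ) * g ≤ R := by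
    have : (K : ℝ) ≤ R / g := Nat.floor_le (by positivity)
    rwa [le_div_iff₀ (by exact_mod_cast hg0)] at this
  calc ((nearMultiples q v R).card : ℝ) ≤ t.card := by exact_mod_cast hle
    _ = 2 * (K * g) := by rw [hcard]; push_cast; ring
    _ ≤ 2 * R := by linarith

theorem card_coprime_near_le (q v u : ℕ) (R : ℝ) (hq : 0 < q) (hv : 0 < v) (hR : 0 ≤ R) :
    ((((Finset.Icc 1 q).filter fun a => Nat.Coprime a q).filter
      fun b : ℕ => |(v : ℝ) * b - u * q| ≤ R).card : ℝ) ≤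
      2 * R / v * (q.totient / q) + 2 * q.divisors.card := by
  have hvR : (0 : ℝ) < v := by exact_mod_cast hv
  set lo : ℝ := (u * q - R) / v with hlo
  set hi : ℝ := (u * q + R) / v with hhi
  have hhi0 : 0 ≤ hi := by positivity
  have hdiv : (1 : ℝ) ≤ q.divisors.card := by
    exact_mod_cast Finset.card_pos.2 ⟨1, Nat.one_mem_divisors.2 hq.ne'⟩
  have hφ : (q.totient : ℝ) / q ≤ 1 := by
    rw [div_le_one (by exact_mod_cast hq)]
    exact_mod_cast Nat.totient_le q
  have hφ0 : (0 : ℝ) ≤ (q.totient : ℝ) / q := by positivity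
  have hsub : ((Finset.Icc 1 q).filter fun a => Nat.Coprime a q).filter
      (fun b : ℕ => |(v : ℝ) * b - u * q| ≤ R) ⊆
      (Finset.Ioc (⌈lo⌉₊ - 1) ⌊hi⌋₊).filter fun b => b.Coprime q := by
    intro b hb
    simp only [Finset.mem_filter, Finset.mem_Icc, Finset.mem_Ioc] at hb ⊢
    obtain ⟨⟨⟨h1, _⟩, h3⟩, h4⟩ := hb
    rw [abs_le] at h4
    refine ⟨⟨?_, ?_⟩, h3⟩
    · have : ⌈lo⌉₊ ≤ b := by
        refine Nat.ceil_le.2 ?_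
        rw [hlo, div_le_iff₀ hvR]
        linarith
      omega
    · refine Nat.le_floor ?_
      rw [hhi, le_div_iff₀ hvR]
      linarith
  have hcard := Nat.cast_le (α := ℝ) |>.2 (Finset.card_le_card hsub)
  refine hcard.trans ?_
  have hRv : 0 ≤ 2 * R / v * (q.totient / q : ℝ) := by positivity
  rcases le_total (⌈lo⌉₊ - 1) ⌊hi⌋₊ with hle | hle
  · have h1 := (abs_le.1 (abs_card_coprime_Ioc_sub_le q _ _ hq hle)).2
    have h2 : ((⌊hi⌋₊ : ℝ) - ((⌈lo⌉₊ - 1 : ℕ) : ℝ)) ≤ 2 * R / v + 1 := by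
      have h3 : (⌊hi⌋₊ : ℝ) ≤ hi := Nat.floor_le hhi0
      have h4 : lo - 1 ≤ ((⌈lo⌉₊ - 1 : ℕ) : ℝ) := by
        have h5 : lo ≤ ⌈lo⌉₊ := Nat.le_ceil lo
        have h6 : (⌈lo⌉₊ : ℝ) ≤ ((⌈lo⌉₊ - 1 : ℕ) : ℝ) + 1 := by
          exact_mod_cast (by omega : ⌈lo⌉₊ ≤ ⌈lo⌉₊ - 1 + 1)
        linarith
      have h7 : hi - lo = 2 * R / v := by rw [hhi, hlo]; ring
      linarith
    have h3 := mul_le_mul_of_nonneg_right h2 hφ0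
    nlinarith
  · rw [Finset.Ioc_eq_empty (by omega)]
    simp
    positivity

theorem card_nearMultiples_le (q v : ℕ) (R : ℝ) (hq : 0 < q) (hv : 0 < v) (hR : 0 ≤ R)
    (hRq : R < q) :
    ((nearMultiples q v R).card : ℝ) ≤
      4 * R * (q.totient / q) + 4 * v * q.divisors.card := by
  have hsub : nearMultiples q v R ⊆ (Finset.range (v + 1)).biUnion fun u =>
      ((Finset.Icc 1 q).filter fun a => Nat.Coprime a q).filter
        fun b : ℕ => |(v : ℝ) * b - u * q| ≤ R := by
    intro b hb
    obtain ⟨⟨hb2, hbc⟩, u, hu⟩ := mem_nearMultiples.1 hb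
    have hqR : (0 : ℝ) < q := by exact_mod_cast hq
    have hbq : (b : ℝ) ≤ q := by exact_mod_cast hb2.2
    have hvR : (0 : ℝ) < v := by exact_mod_cast hv
    have hu' := abs_le.1 hu
    have h0 : 0 ≤ u := by
      by_contra hneg
      have : (u : ℝ) ≤ -1 := by exact_mod_cast (by omega : u ≤ -1)
      have hvb : 0 ≤ (v : ℝ) * b := by positivity
      nlinarith
    lift u to ℕ using h0
    simp only [Finset.mem_biUnion, Finset.mem_range, Finset.mem_filter, Finset.mem_Icc]
    refine ⟨u, ?_, ⟨hb2, hbc⟩, by exact_mod_cast hu⟩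
    by_contra hneg
    have : (v : ℝ) + 1 ≤ u := by exact_mod_cast (by omega : v + 1 ≤ u)
    have h1 : (v : ℝ) * b ≤ v * q := by gcongr
    push_cast at hu'
    nlinarith
  have h1 := (Finset.card_le_card hsub).trans Finset.card_biUnion_le
  have h2 : ((nearMultiples q v R).card : ℝ) ≤ ∑ u ∈ Finset.range (v + 1),
      (2 * R / v * (q.totient / q) + 2 * q.divisors.card : ℝ) := by
    refine (Nat.cast_le (α := ℝ).2 h1).trans ?_
    push_cast
    exact Finset.sum_le_sum fun u _ => card_coprime_near_le q v u R hq hv hR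
  rw [Finset.sum_const, Finset.card_range, nsmul_eq_mul] at h2
  refine h2.trans ?_
  have hvR : (1 : ℝ) ≤ v := by exact_mod_cast hv
  have h3 : ((v + 1 : ℕ) : ℝ) ≤ 2 * v := by push_cast; linarith
  calc _ ≤ 2 * v * (2 * R / v * (q.totient / q) + 2 * q.divisors.card : ℝ) := by gcongr
    _ = _ := by field_simp; ring

/-- The thresholds `1 / (v (c log 2v)^β)` for the quality of a rational approximation with
denominator `v`. -/
noncomputable def approxThreshold (c β : ℝ) (v : ℕ) : ℝ := (v * (c * Real.log (2 * v)) ^ β)⁻¹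

theorem approxThreshold_nonneg (c β : ℝ) (hc : 0 < c) (v : ℕ) : 0 ≤ approxThreshold c β v := by
  rcases Nat.eq_zero_or_pos v with rfl | hv
  · simp [approxThreshold]
  · have : (1 : ℝ) ≤ v := by exact_mod_cast hv
    have : 0 ≤ Real.log (2 * v) := Real.log_nonneg (by linarith)
    unfold approxThreshold
    positivity

theorem summable_approxThreshold (c β : ℝ) (hc : 0 < c) (hβ : 1 < β) :
    Summable (approxThreshold c β) := by
  rw [← summable_condensed_iff_of_nonneg (approxThreshold_nonneg c β hc)]
  · have h1 : (fun k : ℕ => (2 : ℝ) ^ k * approxThreshold c β (2 ^ k)) =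
        fun k : ℕ => ((c * Real.log 2) ^ β)⁻¹ * (1 / ((k + 1 : ℕ) : ℝ) ^ β) := by
      funext k
      have h2 : (2 : ℝ) * ((2 ^ k : ℕ) : ℝ) = 2 ^ (k + 1) := by push_cast; ring
      have hl := Real.log_pos one_lt_two
      rw [approxThreshold, h2, Real.log_pow, show c * (((k + 1 : ℕ) : ℝ) * Real.log 2) =
        (c * Real.log 2) * ((k + 1 : ℕ) : ℝ) by ring,
        Real.mul_rpow (by positivity) (by positivity)]
      push_cast
      field_simp
    rw [h1]
    exact ((summable_nat_add_iff 1).2 (Real.summable_one_div_nat_rpow.2 hβ)).mul_left _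
  · intro m n hm hmn
    have hm1 : (1 : ℝ) ≤ m := by exact_mod_cast hm
    have hmn' : (m : ℝ) ≤ n := by exact_mod_cast hmn
    have hl : 0 < Real.log (2 * m) := Real.log_pos (by linarith)
    unfold approxThreshold
    gcongr

theorem approxThreshold_le_mul (c ε l : ℝ) (hε : 0 < ε) (hl : 0 < l) (v : ℕ)
    (hv : 1 ≤ v) (hlv : l ≤ c * Real.log (2 * v)) :
    approxThreshold c (1 + 2 * ε) v ≤ l ^ (-ε) * approxThreshold c (1 + ε) v := by
  have hpos : 0 < c * Real.log (2 * v) := hl.trans_le hlv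
  have hv0 : (0 : ℝ) < v := by exact_mod_cast hv
  unfold approxThreshold
  rw [show 1 + 2 * ε = (1 + ε) + ε by ring, Real.rpow_add hpos, ← mul_assoc, mul_inv, mul_comm,
    Real.rpow_neg hl.le]
  gcongr

theorem eventually_rpow_le_mul_totient (η : ℝ) (hη : 0 < η) :
    ∀ᶠ q : ℕ in atTop, (q : ℝ) ^ (3 / 4 : ℝ) ≤ η * q.totient := by
  have h1 := ((isLittleO_log_rpow_atTop (show (0 : ℝ) < 1 / 4 by norm_num)).bound hη)
  have h2 := (tendsto_natCast_atTop_atTop (R := ℝ)).eventually h1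
  filter_upwards [h2, eventually_self_le_totient_mul_log_rpow 1 one_pos, eventually_ge_atTop 1]
    with q hq hq2 hq1
  have hq1' : (1 : ℝ) ≤ q := by exact_mod_cast hq1
  have hlog : 0 ≤ Real.log q := Real.log_nonneg hq1'
  rw [Real.norm_of_nonneg hlog, Real.norm_of_nonneg (by positivity)] at hq
  rw [Real.rpow_one] at hq2
  have hpos : 0 < (q : ℝ) ^ (1 / 4 : ℝ) := by positivity
  have h3 : (q : ℝ) ^ (3 / 4 : ℝ) * (q : ℝ) ^ (1 / 4 : ℝ) = q := by
    rw [← Real.rpow_add (by linarith)]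
    norm_num
  refine le_of_mul_le_mul_right ?_ hpos
  rw [h3]
  calc (q : ℝ) ≤ q.totient * Real.log q := hq2
    _ ≤ q.totient * (η * (q : ℝ) ^ (1 / 4 : ℝ)) := by gcongr
    _ = _ := by ring

/-- The proportion of reduced fractions `b / q` that have an unusually good approximation of
denominator at least `V` is small, uniformly in large `q`, when `V` is large. -/
theorem exists_eventually_card_biUnion_nearMultiples_le (c ε η : ℝ) (hc : 0 < c) (hε : 0 < ε)
    (hη : 0 < η) :
    ∃ V : ℕ, ∀ᶠ q : ℕ in atTop, (((Finset.Ico V q).biUnion fun v =>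
      nearMultiples q v (approxThreshold c (1 + 2 * ε) v * q)).card : ℝ) ≤ η * q.totient := by
  set r := approxThreshold c (1 + 2 * ε) with hr
  set s := approxThreshold c (1 + ε) with hs
  have hr0 : ∀ v, 0 ≤ r v := approxThreshold_nonneg c _ hc
  have hs0 : ∀ v, 0 ≤ s v := approxThreshold_nonneg c _ hc
  have hrs : Summable r := summable_approxThreshold c _ hc (by linarith)
  have hss : Summable s := summable_approxThreshold c _ hc (by linarith)
  have htail : ∀ᶠ V : ℕ in atTop, ∑' v, r (v + V) < η / 16 :=
    (tendsto_sum_nat_add r).eventually_lt_const (by positivity)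
  have hsmall : ∀ᶠ v : ℕ in atTop, r v < 1 :=
    hrs.tendsto_atTop_zero.eventually_lt_const one_pos
  obtain ⟨V₁, hV₁⟩ := eventually_atTop.1 hsmall
  obtain ⟨V, hV, hVge⟩ := (htail.and (eventually_ge_atTop (max 1 V₁))).exists
  have hV1 : 1 ≤ V := (le_max_left _ _).trans hVge
  have hVr : ∀ v, V ≤ v → r v < 1 := fun v hv => hV₁ v (((le_max_right _ _).trans hVge).trans hv)
  refine ⟨V, ?_⟩
  have hlog : Tendsto (fun q : ℕ => Real.log q) atTop atTop :=
    Real.tendsto_log_atTop.comp tendsto_natCast_atTop_atTop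
  have hdecay : ∀ᶠ q : ℕ in atTop,
      2 * Real.log q ^ (ε / 2) * (c / 8 * Real.log q) ^ (-ε) * ∑' v, s v ≤ η / 4 := by
    have h1 : Tendsto (fun l : ℝ => 2 * (c / 8) ^ (-ε) * (∑' v, s v) * l ^ (-(ε / 2)))
        atTop (𝓝 (2 * (c / 8) ^ (-ε) * (∑' v, s v) * 0)) :=
      (tendsto_rpow_neg_atTop (by positivity)).const_mul _
    rw [mul_zero] at h1
    have h2 := (h1.comp hlog).eventually_le_const (show 0 < η / 4 by positivity)
    filter_upwards [h2, hlog.eventually_gt_atTop 0] with q hq hq0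
    refine le_trans (le_of_eq ?_) hq
    rw [Real.mul_rpow (by positivity) hq0.le, Function.comp_apply,
      show -(ε / 2) = ε / 2 + -ε by ring, Real.rpow_add hq0]
    ring
  filter_upwards [hdecay, eventually_rpow_le_mul_totient (η / 32) (by positivity),
    eventually_self_le_totient_mul_log_rpow (ε / 2) (by positivity),
    hlog.eventually_gt_atTop 0, eventually_ge_atTop 1] with q hq1 hq2 hq3 hlq hq0
  have hqR : (1 : ℝ) ≤ q := by exact_mod_cast hq0
  set W := ⌊(q : ℝ) ^ (1 / 8 : ℝ)⌋₊ with hW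
  have hWle : (W : ℝ) ≤ (q : ℝ) ^ (1 / 8 : ℝ) := Nat.floor_le (by positivity)
  have hcard : (((Finset.Ico V q).biUnion fun v => nearMultiples q v (r v * q)).card : ℝ) ≤
      ∑ v ∈ Finset.Ico V q, ((nearMultiples q v (r v * q)).card : ℝ) := by
    exact_mod_cast Finset.card_biUnion_le
  refine hcard.trans ?_
  rw [← Finset.sum_filter_add_sum_filter_not _ (· ≤ W)]
  have hfirst : ∑ v ∈ (Finset.Ico V q).filter (· ≤ W), ((nearMultiples q v (r v * q)).card : ℝ) ≤
      η / 4 * q.totient + η / 4 * q.totient := by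
    have h1 : ∀ v ∈ (Finset.Ico V q).filter (· ≤ W),
        ((nearMultiples q v (r v * q)).card : ℝ) ≤
          4 * q.totient * r v + 4 * W * q.divisors.card := by
      intro v hv
      simp only [Finset.mem_filter, Finset.mem_Ico] at hv
      have hvW : (v : ℝ) ≤ W := by exact_mod_cast hv.2
      refine (card_nearMultiples_le q v (r v * q) hq0 (by omega)
        (mul_nonneg (hr0 v) (by positivity)) ?_).trans ?_
      · have := hVr v hv.1.1
        nlinarith
      · refine add_le_add (le_of_eq ?_) ?_
        · field_simp
        · gcongr
    refine (Finset.sum_le_sum h1).trans ?_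
    rw [Finset.sum_add_distrib, ← Finset.mul_sum, Finset.sum_const, nsmul_eq_mul]
    refine add_le_add ?_ ?_
    · have h2 : ∑ v ∈ (Finset.Ico V q).filter (· ≤ W), r v ≤ ∑' v, r (v + V) := by
        calc ∑ v ∈ (Finset.Ico V q).filter (· ≤ W), r v ≤ ∑ v ∈ Finset.Ico V q, r v :=
              Finset.sum_le_sum_of_subset_of_nonneg (Finset.filter_subset _ _)
                fun v _ _ => hr0 v
          _ = ∑ v ∈ Finset.range (q - V), r (v + V) := by
              rw [Finset.sum_Ico_eq_sum_range]
              simp_rw [add_comm V]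
          _ ≤ _ := ((summable_nat_add_iff V).2 hrs).sum_le_tsum _ fun v _ => hr0 _
      have hφ : (0 : ℝ) ≤ q.totient := by positivity
      nlinarith
    · have h2 : (((Finset.Ico V q).filter (· ≤ W)).card : ℝ) ≤ W := by
        have : (Finset.Ico V q).filter (· ≤ W) ⊆ Finset.Icc 1 W := by
          intro v hv
          simp only [Finset.mem_filter, Finset.mem_Ico] at hv
          simp only [Finset.mem_Icc]
          omega
        have := Finset.card_le_card this
        rw [Nat.card_Icc, Nat.add_sub_cancel] at this
        exact_mod_cast this
      have h3 : (q.divisors.card : ℝ) ≤ 2 * (q : ℝ) ^ (1 / 2 : ℝ) := by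
        rw [← Real.sqrt_eq_rpow]
        have h4 : (q.divisors.card : ℝ) ≤ 2 * (q.sqrt : ℝ) := by
          exact_mod_cast card_divisors_le_two_mul_sqrt q
        have := Real.nat_sqrt_le_real_sqrt (a := q)
        linarith
      calc _ ≤ (q : ℝ) ^ (1 / 8 : ℝ) *
            (4 * (q : ℝ) ^ (1 / 8 : ℝ) * (2 * (q : ℝ) ^ (1 / 2 : ℝ))) := by
            gcongr
            exact h2.trans hWle
        _ = 8 * (q : ℝ) ^ (3 / 4 : ℝ) := by
            rw [show (3 / 4 : ℝ) = 1 / 8 + 1 / 8 + 1 / 2 by norm_num,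
              Real.rpow_add (by linarith), Real.rpow_add (by linarith)]
            ring
        _ ≤ 8 * (η / 32 * q.totient) := by gcongr
        _ = _ := by ring
  have hsecond : ∑ v ∈ (Finset.Ico V q).filter (¬ · ≤ W),
      ((nearMultiples q v (r v * q)).card : ℝ) ≤ η / 4 * q.totient := by
    have h1 : ∀ v ∈ (Finset.Ico V q).filter (¬ · ≤ W),
        ((nearMultiples q v (r v * q)).card : ℝ) ≤
          2 * q * (c / 8 * Real.log q) ^ (-ε) * s v := by
      intro v hv
      simp only [Finset.mem_filter, Finset.mem_Ico, not_le] at hv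
      have hv1 : 1 ≤ v := by omega
      have hvR : (0 : ℝ) < v := by exact_mod_cast hv1
      refine (card_nearMultiples_le_of_lt q v (r v * q) hv1 hv.1.2
        (mul_nonneg (hr0 v) (by positivity))).trans ?_
      have h2 : r v ≤ (c / 8 * Real.log q) ^ (-ε) * s v := by
        refine approxThreshold_le_mul c ε _ hε (by positivity) v hv1 ?_
        have h3 : (q : ℝ) ^ (1 / 8 : ℝ) ≤ v := (Nat.floor_lt (by positivity)).1 hv.2 |>.le
        have h4 := Real.log_le_log (by positivity) h3
        rw [Real.log_rpow (by linarith)] at h4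
        have h5 : Real.log v ≤ Real.log (2 * v) := Real.log_le_log hvR (by linarith)
        nlinarith
      nlinarith
    refine (Finset.sum_le_sum h1).trans ?_
    rw [← Finset.mul_sum]
    have h2 : ∑ v ∈ (Finset.Ico V q).filter (¬ · ≤ W), s v ≤ ∑' v, s v :=
      hss.sum_le_tsum _ fun v _ => hs0 v
    have hS : 0 ≤ ∑' v, s v := tsum_nonneg hs0
    calc _ ≤ 2 * (q.totient * Real.log q ^ (ε / 2)) * (c / 8 * Real.log q) ^ (-ε) * ∑' v, s v := by
          gcongr
          exact Finset.sum_nonneg fun v _ => hs0 v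
      _ = q.totient * (2 * Real.log q ^ (ε / 2) * (c / 8 * Real.log q) ^ (-ε) * ∑' v, s v) := by
          ring
      _ ≤ q.totient * (η / 4) := by gcongr
      _ = _ := by ring
  have hφ : (0 : ℝ) ≤ q.totient := by positivity
  nlinarith

theorem tendsto_card_divisors_div_totient :
    Tendsto (fun q : ℕ => (q.divisors.card : ℝ) / q.totient) atTop (𝓝 0) := by
  rw [Metric.tendsto_atTop']
  intro η hη
  have h := (eventually_rpow_le_mul_totient (η / 4) (by positivity)).and (eventually_ge_atTop 1)
  obtain ⟨N, hN⟩ := eventually_atTop.1 h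
  refine ⟨N, fun q hq => ?_⟩
  obtain ⟨h1, hq0⟩ := hN q hq.le
  have hφ : (0 : ℝ) < q.totient := by exact_mod_cast Nat.totient_pos.2 hq0
  have hq1 : (1 : ℝ) ≤ q := by exact_mod_cast hq0
  rw [Real.dist_0_eq_abs, abs_of_nonneg (by positivity), div_lt_iff₀ hφ]
  have h4 : (q.divisors.card : ℝ) ≤ 2 * (q.sqrt : ℝ) := by
    exact_mod_cast card_divisors_le_two_mul_sqrt q
  have h5 := Real.nat_sqrt_le_real_sqrt (a := q)
  have h6 : √(q : ℝ) ≤ (q : ℝ) ^ (3 / 4 : ℝ) := by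
    rw [Real.sqrt_eq_rpow]
    exact Real.rpow_le_rpow_of_exponent_le hq1 (by norm_num)
  nlinarith

theorem abs_sum_coprime_Ioc_sub_integral_le (g : ℝ → ℝ) (q N i : ℕ) (ε B : ℝ) (hq : 0 < q)
    (hg : Continuous g) (hB : |g (i / N)| ≤ B)
    (hε : ∀ x ∈ Set.Icc ((i : ℝ) / N) ((i + 1 : ℝ) / N), |g x - g (i / N)| ≤ ε) (hN : 0 < N) :
    |∑ b ∈ (Finset.Ioc (i * q / N) ((i + 1) * q / N)).filter (fun b => b.Coprime q), g (b / q) -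
      q.totient * ∫ x in ((i : ℝ) / N)..((i + 1 : ℝ) / N), g x| ≤
      ε * ((Finset.Ioc (i * q / N) ((i + 1) * q / N)).filter (fun b => b.Coprime q)).card +
        B * (1 + q.divisors.card) + q.totient * (ε / N) := by
  set s := (Finset.Ioc (i * q / N) ((i + 1) * q / N)).filter (fun b => b.Coprime q) with hs
  have hqR : (0 : ℝ) < q := by exact_mod_cast hq
  have hNR : (0 : ℝ) < N := by exact_mod_cast hN
  have hB0 : 0 ≤ B := (abs_nonneg _).trans hB
  have hlen : (i + 1 : ℝ) / N - i / N = 1 / N := by ring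
  have hle : (i : ℝ) / N ≤ (i + 1) / N := by gcongr; linarith
  have h1 : |∑ b ∈ s, g (b / q) - s.card * g (i / N)| ≤ ε * s.card := by
    rw [← nsmul_eq_mul, ← Finset.sum_const, ← Finset.sum_sub_distrib]
    refine (Finset.abs_sum_le_sum_abs _ _).trans ?_
    rw [mul_comm, ← nsmul_eq_mul]
    refine Finset.sum_le_card_nsmul _ _ _ fun b hb => hε _ ?_
    simp only [hs, Finset.mem_filter, Finset.mem_Ioc] at hb
    have h2 : i * q < b * N := (Nat.div_lt_iff_lt_mul hN).1 hb.1.1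
    have h3 : b * N ≤ (i + 1) * q := (Nat.le_div_iff_mul_le hN).1 hb.1.2
    have h2' : (i : ℝ) * q < b * N := by exact_mod_cast h2
    have h3' : (b : ℝ) * N ≤ (i + 1) * q := by exact_mod_cast h3
    constructor
    · rw [div_le_div_iff₀ hNR hqR]; exact h2'.le
    · rw [div_le_div_iff₀ hqR hNR]; exact h3'
  have h2 : |(s.card : ℝ) - q.totient / N| ≤ 1 + q.divisors.card := by
    have hmono : i * q / N ≤ (i + 1) * q / N := Nat.div_le_div_right (by nlinarith)
    have h3 := abs_card_coprime_Ioc_sub_le q _ _ hq hmono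
    rw [← hs] at h3
    have hφ : (q.totient : ℝ) / q ≤ 1 := by
      rw [div_le_one hqR]
      exact_mod_cast Nat.totient_le q
    have hφ0 : (0 : ℝ) ≤ (q.totient : ℝ) / q := by positivity
    have key : ∀ n : ℕ, ((n / N : ℕ) : ℝ) ≤ n / N ∧ (n : ℝ) / N < (n / N : ℕ) + 1 := fun n =>
      ⟨Nat.cast_div_le, by rw [← Nat.floor_div_eq_div (K := ℝ)]; exact Nat.lt_floor_add_one _⟩
    have k1 := key (i * q)
    have k2 := key ((i + 1) * q)
    have h4 : |((((i + 1) * q / N : ℕ) : ℝ) - ((i * q / N : ℕ) : ℝ)) - q / N| ≤ 1 := by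
      have : (((i + 1) * q : ℕ) : ℝ) / N - ((i * q : ℕ) : ℝ) / N = q / N := by
        push_cast; ring
      rw [abs_le]
      constructor <;> linarith [k1.1, k1.2, k2.1, k2.2]
    have h5 : |(((((i + 1) * q / N : ℕ) : ℝ) - ((i * q / N : ℕ) : ℝ)) - q / N) *
        (q.totient / q)| ≤ 1 := by
      rw [abs_mul, abs_of_nonneg hφ0]
      exact mul_le_one₀ h4 hφ0 hφ
    have h6 : (s.card : ℝ) - q.totient / N =
        ((s.card : ℝ) - ((((i + 1) * q / N : ℕ) : ℝ) - ((i * q / N : ℕ) : ℝ)) *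
          (q.totient / q)) + ((((i + 1) * q / N : ℕ) : ℝ) - ((i * q / N : ℕ) : ℝ) - q / N) *
        (q.totient / q) := by
      field_simp
      ring
    rw [h6]
    refine (abs_add_le _ _).trans ?_
    linarith
  have h3 : |(∫ x in ((i : ℝ) / N)..((i + 1 : ℝ) / N), g x) - g (i / N) / N| ≤ ε / N := by
    have h4 : (∫ x in ((i : ℝ) / N)..((i + 1 : ℝ) / N), g x) - g (i / N) / N =
        ∫ x in ((i : ℝ) / N)..((i + 1 : ℝ) / N), (g x - g (i / N)) := by
      rw [intervalIntegral.integral_sub (hg.intervalIntegrable _ _) (by simp),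
        intervalIntegral.integral_const, hlen, smul_eq_mul]
      ring
    rw [h4]
    have h5 := intervalIntegral.norm_integral_le_of_norm_le_const (C := ε)
      (f := fun x => g x - g (i / N)) (a := (i : ℝ) / N) (b := (i + 1 : ℝ) / N) ?_
    · rw [hlen, abs_of_pos (by positivity), Real.norm_eq_abs] at h5
      refine h5.trans (le_of_eq ?_)
      ring
    · intro x hx
      rw [Set.uIoc_of_le hle] at hx
      exact hε x ⟨hx.1.le, hx.2⟩
  have hrw : ∑ b ∈ s, g (b / q) - q.totient * ∫ x in ((i : ℝ) / N)..((i + 1 : ℝ) / N), g x =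
      (∑ b ∈ s, g (b / q) - s.card * g (i / N)) + g (i / N) * ((s.card : ℝ) - q.totient / N) -
        q.totient * ((∫ x in ((i : ℝ) / N)..((i + 1 : ℝ) / N), g x) - g (i / N) / N) := by
    ring
  rw [hrw]
  refine (abs_sub _ _).trans (add_le_add ((abs_add_le _ _).trans (add_le_add h1 ?_)) ?_)
  · rw [abs_mul]
    gcongr
  · rw [abs_mul, abs_of_nonneg (by positivity : (0 : ℝ) ≤ q.totient)]
    gcongr

/-- Reduced fractions with denominator `q` equidistribute in the unit interval as `q → ∞`. -/
theorem tendsto_sum_coprime_div_totient (g : ℝ → ℝ) (hg : Continuous g) :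
    Tendsto (fun q : ℕ => (∑ b ∈ (Finset.Icc 1 q).filter fun a => Nat.Coprime a q,
      g ((b : ℝ) / q)) / (q.totient : ℝ)) atTop (𝓝 (∫ x in Set.Icc (0 : ℝ) 1, g x)) := by
  rw [MeasureTheory.integral_Icc_eq_integral_Ioc, ← intervalIntegral.integral_of_le zero_le_one]
  obtain ⟨B, hB⟩ := (isCompact_Icc (a := (0 : ℝ)) (b := 1)).exists_bound_of_continuousOn
    hg.continuousOn
  have huc := isCompact_Icc (a := (0 : ℝ)) (b := 1) |>.uniformContinuousOn_of_continuous
    hg.continuousOn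
  rw [Metric.uniformContinuousOn_iff] at huc
  rw [Metric.tendsto_atTop]
  intro ε hε
  obtain ⟨δ, hδ, huc⟩ := huc (ε / 4) (by positivity)
  obtain ⟨n, hn⟩ := exists_nat_one_div_lt hδ
  set N := n + 1 with hN
  have hN0 : 0 < N := Nat.succ_pos n
  have hNR : (0 : ℝ) < N := by exact_mod_cast hN0
  have hB0 : 0 ≤ B := (norm_nonneg _).trans (hB 0 (by simp))
  have hsmall : Tendsto (fun q : ℕ => (N * B * 2) * ((q.divisors.card : ℝ) / q.totient)) atTop
      (𝓝 ((N * B * 2) * 0)) := tendsto_card_divisors_div_totient.const_mul _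
  rw [mul_zero] at hsmall
  have hev := (hsmall.eventually_lt_const (show 0 < ε / 4 by positivity)).and
    (eventually_ge_atTop 1)
  obtain ⟨Q, hQ⟩ := eventually_atTop.1 hev
  refine ⟨Q, fun q hq => ?_⟩
  obtain ⟨hd, hq0⟩ := hQ q hq
  have hφ : (0 : ℝ) < q.totient := by exact_mod_cast Nat.totient_pos.2 hq0
  set s : ℕ → Finset ℕ := fun i =>
    (Finset.Ioc (i * q / N) ((i + 1) * q / N)).filter (fun b => b.Coprime q) with hs
  have hpart : ∀ F : ℕ → ℝ, ∑ b ∈ (Finset.Icc 1 q).filter (fun a => Nat.Coprime a q), F b =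
      ∑ i ∈ Finset.range N, ∑ b ∈ s i, F b := by
    intro F
    have h1 : ∀ i ∈ Finset.range N, ∑ b ∈ s i, F b =
        (∑ b ∈ (Finset.Ioc 0 ((i + 1) * q / N)).filter (fun b => b.Coprime q), F b) -
          ∑ b ∈ (Finset.Ioc 0 (i * q / N)).filter (fun b => b.Coprime q), F b := by
      intro i _
      have hmono : i * q / N ≤ (i + 1) * q / N := Nat.div_le_div_right (by nlinarith)
      rw [Finset.sum_filter, Finset.sum_filter, Finset.sum_filter,
        ← Finset.sum_Ioc_consecutive _ (Nat.zero_le _) hmono]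
      ring
    rw [Finset.sum_congr rfl h1, Finset.sum_range_sub
      (fun i => ∑ b ∈ (Finset.Ioc 0 (i * q / N)).filter (fun b => b.Coprime q), F b),
      Nat.mul_div_cancel_left _ hN0]
    simp
    rfl
  have hint : ∫ x in (0 : ℝ)..1, g x =
      ∑ i ∈ Finset.range N, ∫ x in ((i : ℝ) / N)..((i + 1 : ℝ) / N), g x := by
    have := intervalIntegral.sum_integral_adjacent_intervals (f := g) (μ := volume)
      (a := fun i : ℕ => (i : ℝ) / N) (n := N) fun k _ => hg.intervalIntegrable _ _
    rw [div_self hNR.ne', Nat.cast_zero, zero_div] at this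
    rw [← this]
    push_cast
    rfl
  have hterm : ∀ i ∈ Finset.range N, |∑ b ∈ s i, g ((b : ℝ) / q) -
      q.totient * ∫ x in ((i : ℝ) / N)..((i + 1 : ℝ) / N), g x| ≤
      ε / 4 * (s i).card + B * (1 + q.divisors.card) + q.totient * (ε / 4 / N) := by
    intro i hi
    have hiN : (i : ℝ) + 1 ≤ N := by exact_mod_cast Finset.mem_range.1 hi
    have hi0 : (0 : ℝ) ≤ i := by positivity
    have hmem : (i : ℝ) / N ∈ Set.Icc (0 : ℝ) 1 :=
      ⟨by positivity, by rw [div_le_one hNR]; linarith⟩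
    refine abs_sum_coprime_Ioc_sub_integral_le g q N i _ B hq0 hg (hB _ hmem) ?_ hN0
    intro x hx
    refine (huc x ⟨hmem.1.trans hx.1, hx.2.trans (by rw [div_le_one hNR]; exact hiN)⟩ _ hmem
      ?_).le
    rw [Real.dist_eq, abs_of_nonneg (by linarith [hx.1])]
    have : (i + 1 : ℝ) / N - i / N = 1 / N := by ring
    have h2 : (1 : ℝ) / N < δ := by rw [hN]; push_cast; exact hn
    linarith [hx.2]
  have hcard : ∑ i ∈ Finset.range N, ((s i).card : ℝ) = q.totient := by
    have h1 := hpart fun _ => 1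
    simp only [Finset.sum_const, nsmul_eq_mul, mul_one] at h1
    rw [← h1, ← card_coprime_Ioc_self]
    rfl
  have hd1 : (1 : ℝ) ≤ q.divisors.card := by
    exact_mod_cast Finset.card_pos.2 ⟨1, Nat.one_mem_divisors.2 (by omega)⟩
  have htotal : |∑ b ∈ (Finset.Icc 1 q).filter (fun a => Nat.Coprime a q), g ((b : ℝ) / q) -
      q.totient * ∫ x in (0 : ℝ)..1, g x| ≤
      ε / 4 * q.totient + N * (B * (1 + q.divisors.card)) + q.totient * (ε / 4) := by
    rw [hpart fun b => g ((b : ℝ) / q), hint, Finset.mul_sum, ← Finset.sum_sub_distrib]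
    refine (Finset.abs_sum_le_sum_abs _ _).trans ((Finset.sum_le_sum hterm).trans ?_)
    rw [Finset.sum_add_distrib, Finset.sum_add_distrib, ← Finset.mul_sum, hcard, Finset.sum_const,
      Finset.sum_const, Finset.card_range, nsmul_eq_mul, nsmul_eq_mul]
    refine le_of_eq ?_
    field_simp
  have hd' : N * (B * (1 + q.divisors.card)) < ε / 4 * q.totient := by
    rw [← mul_div_assoc, div_lt_iff₀ hφ] at hd
    refine lt_of_le_of_lt ?_ hd
    have : N * B * (1 + q.divisors.card : ℝ) ≤ N * B * (2 * q.divisors.card) := by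
      gcongr
      linarith
    linarith
  rw [Real.dist_eq, ← mul_lt_mul_iff_left₀ hφ, ← abs_of_pos hφ, ← abs_mul, abs_of_pos hφ, sub_mul,
    div_mul_cancel₀ _ hφ.ne', mul_comm (∫ x in (0 : ℝ)..1, g x)]
  nlinarith

/-- The complete quotients of the continued fraction expansion of `x`. -/
noncomputable def cfTail (x : ℝ) : ℕ → ℝ
  | 0 => x
  | n + 1 => (Int.fract (cfTail x n))⁻¹

theorem cfTail_succ' (x : ℝ) (n : ℕ) : cfTail (Int.fract x)⁻¹ n = cfTail x (n + 1) := by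
  induction n with
  | zero => rfl
  | succ n ih => rw [cfTail, ih, ← cfTail]

theorem cfb_eq_floor_cfTail (x : ℝ) (n : ℕ) : cfb n x = ⌊cfTail x n⌋ := by
  induction n generalizing x with
  | zero => rfl
  | succ n ih => rw [cfb, ih, cfTail_succ']

/-- The continued fraction expansion of `x` has at least `N` partial quotients after the
integer part. -/
def CfLongerThan (x : ℝ) (N : ℕ) : Prop := ∀ i < N, Int.fract (cfTail x i) ≠ 0

theorem CfLongerThan.mono {x : ℝ} {M N : ℕ} (hx : CfLongerThan x N) (hMN : M ≤ N) :
    CfLongerThan x M := fun i hi => hx i (hi.trans_le hMN)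

theorem cfTail_eq_add_fract (x : ℝ) (n : ℕ) :
    cfTail x n = cfb n x + Int.fract (cfTail x n) := by
  rw [cfb_eq_floor_cfTail, Int.floor_add_fract]

theorem one_le_cfb {x : ℝ} {n : ℕ} (hx : CfLongerThan x (n + 1)) : 1 ≤ cfb (n + 1) x := by
  rw [cfb_eq_floor_cfTail, Int.le_floor, cfTail]
  have h0 := hx n n.lt_succ_self
  have h1 : 0 < Int.fract (cfTail x n) := lt_of_le_of_ne (Int.fract_nonneg _) h0.symm
  push_cast
  exact (one_le_inv₀ h1).2 (Int.fract_lt_one _).le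

theorem cfPQ_snd_pos_and_le {x : ℝ} {n : ℕ} (hx : CfLongerThan x (n + 1)) :
    1 ≤ (cfPQ x n).2 ∧ (cfPQ x n).2 ≤ (cfPQ x (n + 1)).2 := by
  induction n with
  | zero => exact ⟨le_rfl, one_le_cfb hx⟩
  | succ n ih =>
    obtain ⟨h1, h2⟩ := ih (hx.mono (by omega))
    have hb := one_le_cfb hx
    have h3 : 1 ≤ (cfPQ x (n + 1)).2 := h1.trans h2
    refine ⟨h3, ?_⟩
    show _ ≤ cfb (n + 2) x * (cfPQ x (n + 1)).2 + (cfPQ x n).2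
    nlinarith

theorem cfPQ_snd_le {x : ℝ} {n : ℕ} (hx : CfLongerThan x (n + 1)) :
    (cfPQ x n).2 ≤ (cfPQ x (n + 1)).2 := (cfPQ_snd_pos_and_le hx).2

theorem one_le_cfPQ_snd {x : ℝ} {n : ℕ} (hx : CfLongerThan x n) : 1 ≤ (cfPQ x n).2 := by
  cases n with
  | zero => exact le_rfl
  | succ n => exact (cfPQ_snd_pos_and_le hx).1.trans (cfPQ_snd_pos_and_le hx).2

theorem add_le_cfPQ_snd {x : ℝ} {n : ℕ} (hx : CfLongerThan x (n + 2)) :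
    (cfPQ x (n + 1)).2 + (cfPQ x n).2 ≤ (cfPQ x (n + 2)).2 := by
  have hb := one_le_cfb hx
  have h3 := one_le_cfPQ_snd (hx.mono (by omega : n + 1 ≤ n + 2))
  show _ ≤ cfb (n + 2) x * (cfPQ x (n + 1)).2 + (cfPQ x n).2
  nlinarith

theorem cfPQ_snd_lt {x : ℝ} {n : ℕ} (hx : CfLongerThan x (n + 2)) :
    (cfPQ x (n + 1)).2 < (cfPQ x (n + 2)).2 := by
  have := add_le_cfPQ_snd hx
  have := one_le_cfPQ_snd (hx.mono (by omega : n ≤ n + 2))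
  omega

theorem cfPQ_snd_mono {x : ℝ} {m n : ℕ} (hmn : m ≤ n) (hx : CfLongerThan x n) :
    (cfPQ x m).2 ≤ (cfPQ x n).2 := by
  induction n, hmn using Nat.le_induction with
  | base => exact le_rfl
  | succ n _ ih => exact (ih (hx.mono n.le_succ)).trans (cfPQ_snd_le hx)

theorem two_pow_le_cfPQ_snd_sq {x : ℝ} {n : ℕ} (hx : CfLongerThan x n) :
    2 ^ n ≤ 2 * (cfPQ x n).2 ^ 2 := by
  induction n using Nat.twoStepInduction with
  | zero => simp [cfPQ]
  | one =>
    have := one_le_cfPQ_snd hx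
    nlinarith
  | more n ih _ =>
    have h1 := ih (hx.mono (by omega))
    have h2 := add_le_cfPQ_snd hx
    have h3 := cfPQ_snd_le (hx.mono (by omega : n + 1 ≤ n + 2))
    have h4 := one_le_cfPQ_snd (hx.mono (by omega : n ≤ n + 2))
    have h5 : 2 * (cfPQ x n).2 ≤ (cfPQ x (n + 2)).2 := by omega
    have h6 : (2 * (cfPQ x n).2) ^ 2 ≤ (cfPQ x (n + 2)).2 ^ 2 :=
      pow_le_pow_left₀ (by omega) h5 2
    rw [pow_add]
    linarith

theorem cfPQ_det (x : ℝ) (n : ℕ) :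
    (cfPQ x (n + 1)).1 * (cfPQ x n).2 - (cfPQ x n).1 * (cfPQ x (n + 1)).2 = (-1) ^ n := by
  induction n with
  | zero =>
    simp only [cfPQ]
    ring
  | succ n ih =>
    have h : cfPQ x (n + 1 + 1) = (cfb (n + 2) x * (cfPQ x (n + 1)).1 + (cfPQ x n).1,
      cfb (n + 2) x * (cfPQ x (n + 1)).2 + (cfPQ x n).2) := rfl
    rw [h, pow_succ, ← ih]
    ring

theorem mul_cfPQ_eq {x : ℝ} {n : ℕ} (hx : CfLongerThan x (n + 1)) :
    x * ((cfPQ x (n + 1)).2 + (cfPQ x n).2 * Int.fract (cfTail x (n + 1))) =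
      (cfPQ x (n + 1)).1 + (cfPQ x n).1 * Int.fract (cfTail x (n + 1)) := by
  induction n with
  | zero =>
    have h0 := hx 0 one_pos
    have h1 := cfTail_eq_add_fract x 0
    have h2 := cfTail_eq_add_fract x 1
    have h3 : Int.fract (cfTail x 0) * cfTail x 1 = 1 := mul_inv_cancel₀ h0
    have h4 : cfTail x 0 = x := rfl
    simp only [cfPQ]
    push_cast
    rw [h4] at h1 h3
    linear_combination (-x + cfb 0 x) * h2 + cfTail x 1 * h1 + h3
  | succ n ih =>
    have h0 := hx (n + 1) (by omega)
    have h1 := ih (hx.mono (by omega))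
    have h2 := cfTail_eq_add_fract x (n + 2)
    have h3 : Int.fract (cfTail x (n + 1)) * cfTail x (n + 2) = 1 := mul_inv_cancel₀ h0
    have h : cfPQ x (n + 1 + 1) = (cfb (n + 2) x * (cfPQ x (n + 1)).1 + (cfPQ x n).1,
      cfb (n + 2) x * (cfPQ x (n + 1)).2 + (cfPQ x n).2) := rfl
    rw [h]
    push_cast
    linear_combination (-x * (cfPQ x (n + 1)).2 + (cfPQ x (n + 1)).1) * h2
      + cfTail x (n + 2) * h1 + (- x * (cfPQ x n).2 + (cfPQ x n).1) * h3

theorem mul_cfPQ_sub_mul_eq {x : ℝ} {n : ℕ} (hx : CfLongerThan x (n + 1)) :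
    (x * (cfPQ x n).2 - (cfPQ x n).1) *
      ((cfPQ x (n + 1)).2 + (cfPQ x n).2 * Int.fract (cfTail x (n + 1))) = (-1) ^ n := by
  have h1 := mul_cfPQ_eq hx
  have h2 : ((cfPQ x (n + 1)).1 * (cfPQ x n).2 - (cfPQ x n).1 * (cfPQ x (n + 1)).2 : ℝ) =
    (-1) ^ n := by exact_mod_cast cfPQ_det x n
  linear_combination (cfPQ x n).2 * h1 + h2

theorem abs_mul_cfPQ_sub_mul_eq {x : ℝ} {n : ℕ} (hx : CfLongerThan x (n + 1)) :
    |x * (cfPQ x n).2 - (cfPQ x n).1| *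
      ((cfPQ x (n + 1)).2 + (cfPQ x n).2 * Int.fract (cfTail x (n + 1))) = 1 := by
  have h := congrArg abs (mul_cfPQ_sub_mul_eq hx)
  rw [abs_mul, abs_pow, abs_neg, abs_one, one_pow] at h
  rwa [abs_of_nonneg (a := _ + _)] at h
  have h1 : (1 : ℝ) ≤ (cfPQ x n).2 := by exact_mod_cast one_le_cfPQ_snd (hx.mono n.le_succ)
  have h2 : (1 : ℝ) ≤ (cfPQ x (n + 1)).2 := by exact_mod_cast one_le_cfPQ_snd hx
  have := Int.fract_nonneg (cfTail x (n + 1))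
  positivity

theorem abs_mul_cfPQ_sub_le {x : ℝ} {n : ℕ} (hx : CfLongerThan x (n + 1)) :
    |x * (cfPQ x n).2 - (cfPQ x n).1| ≤ ((cfPQ x (n + 1)).2 : ℝ)⁻¹ := by
  have h := abs_mul_cfPQ_sub_mul_eq hx
  have h1 : (1 : ℝ) ≤ (cfPQ x n).2 := by exact_mod_cast one_le_cfPQ_snd (hx.mono n.le_succ)
  have h2 : (1 : ℝ) ≤ (cfPQ x (n + 1)).2 := by exact_mod_cast one_le_cfPQ_snd hx
  have h3 := Int.fract_nonneg (cfTail x (n + 1))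
  rw [← one_div, le_div_iff₀ (by linarith), ← h]
  gcongr
  have : 0 ≤ (cfPQ x n).2 * Int.fract (cfTail x (n + 1)) := by positivity
  linarith

theorem exists_fract_cfTail_eq_zero (b : ℤ) (q : ℕ) (hq : 0 < q) :
    ∃ n, Int.fract (cfTail ((b : ℝ) / q) n) = 0 := by
  by_contra! hcon
  set x : ℝ := (b : ℝ) / q with hx
  have hq' : (0 : ℝ) < q := by exact_mod_cast hq
  have hlong : ∀ N, CfLongerThan x N := fun N i _ => hcon i
  have hle : ∀ n, (cfPQ x (n + 1)).2 ≤ q := by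
    intro n
    have h := abs_mul_cfPQ_sub_mul_eq (hlong (n + 1))
    have h1 : (1 : ℝ) ≤ (cfPQ x n).2 := by exact_mod_cast one_le_cfPQ_snd (hlong n)
    have h2 : (1 : ℝ) ≤ (cfPQ x (n + 1)).2 := by exact_mod_cast one_le_cfPQ_snd (hlong (n + 1))
    have h3 := Int.fract_nonneg (cfTail x (n + 1))
    have h4 : |x * (cfPQ x n).2 - (cfPQ x n).1| * q =
        (|b * (cfPQ x n).2 - q * (cfPQ x n).1| : ℤ) := by
      conv_lhs => rw [← abs_of_pos hq', ← abs_mul]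
      push_cast
      congr 1
      rw [hx]
      field_simp
    have h5 : (1 : ℝ) ≤ (|b * (cfPQ x n).2 - q * (cfPQ x n).1| : ℤ) := by
      norm_cast
      apply Int.one_le_abs
      intro h0
      rw [h0] at h4
      simp only [abs_zero, Int.cast_zero, mul_eq_zero, hq'.ne', or_false] at h4
      rw [h4] at h
      simp at h
    rw [← h4] at h5
    have h6 : ((cfPQ x (n + 1)).2 : ℝ) ≤ q := by
      set D := ((cfPQ x (n + 1)).2 + (cfPQ x n).2 * Int.fract (cfTail x (n + 1)) : ℝ) with hD
      have hDq : ((cfPQ x (n + 1)).2 : ℝ) ≤ D := by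
        rw [hD]
        have : 0 ≤ (cfPQ x n).2 * Int.fract (cfTail x (n + 1)) := by positivity
        linarith
      refine hDq.trans ?_
      calc D = 1 * D := (one_mul D).symm
        _ ≤ (|x * (cfPQ x n).2 - (cfPQ x n).1| * q) * D := by gcongr
        _ = (|x * (cfPQ x n).2 - (cfPQ x n).1| * D) * q := by ring
        _ = q := by rw [h, one_mul]
    exact_mod_cast h6
  have hq1 : (1 : ℤ) ≤ (q : ℤ) ^ 2 := by exact_mod_cast Nat.one_le_pow _ _ hq
  obtain ⟨n, hn⟩ := pow_unbounded_of_one_lt (2 * (q : ℤ) ^ 2) (one_lt_two : (1 : ℤ) < 2)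
  have h1 := two_pow_le_cfPQ_snd_sq (hlong (n + 1))
  have h2 := hle n
  have h3 := one_le_cfPQ_snd (hlong (n + 1))
  have h4 : (cfPQ x (n + 1)).2 ^ 2 ≤ (q : ℤ) ^ 2 := pow_le_pow_left₀ (by omega) h2 2
  rw [pow_succ] at h1
  linarith

/-- The last convergent of a reduced fraction `b / q` is the fraction itself. -/
theorem exists_cfPQ_eq (b : ℤ) (q : ℕ) (hq : 0 < q) (hbq : IsCoprime b q)
    (hlong : CfLongerThan ((b : ℝ) / q) 1) :
    ∃ n, CfLongerThan ((b : ℝ) / q) (n + 1) ∧ Int.fract (cfTail ((b : ℝ) / q) (n + 1)) = 0 ∧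
      cfPQ ((b : ℝ) / q) (n + 1) = (b, (q : ℤ)) := by
  classical
  have hex := exists_fract_cfTail_eq_zero b q hq
  set x : ℝ := (b : ℝ) / q with hx
  obtain ⟨n, hn⟩ : ∃ n, Nat.find hex = n + 1 := by
    refine Nat.exists_eq_succ_of_ne_zero fun h0 => hlong 0 one_pos ?_
    rw [← h0]
    exact Nat.find_spec hex
  have hlongn : CfLongerThan x (n + 1) := fun i hi => Nat.find_min hex (hn ▸ hi)
  have h0 : Int.fract (cfTail x (n + 1)) = 0 := by rw [← hn]; exact Nat.find_spec hex
  refine ⟨n, hlongn, h0, ?_⟩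
  have h1 := mul_cfPQ_eq hlongn
  have hq' : (0 : ℝ) < q := by exact_mod_cast hq
  rw [h0, mul_zero, add_zero, mul_zero, add_zero, hx, div_mul_eq_mul_div,
    div_eq_iff hq'.ne', ← hx] at h1
  have h2 : b * (cfPQ x (n + 1)).2 = (cfPQ x (n + 1)).1 * q := by exact_mod_cast h1
  have h3 := one_le_cfPQ_snd hlongn
  have hdet := cfPQ_det x n
  set P := (cfPQ x (n + 1)).1
  set Q := (cfPQ x (n + 1)).2
  have hPQ : IsCoprime P Q := by
    refine ⟨(-1) ^ n * (cfPQ x n).2, -(-1) ^ n * (cfPQ x n).1, ?_⟩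
    have : ((-1 : ℤ) ^ n) * (-1) ^ n = 1 := by rw [← mul_pow]; simp
    linear_combination (-1) ^ n * hdet + this
  have hd1 : (q : ℤ) ∣ Q := hbq.symm.dvd_of_dvd_mul_left ⟨P, by linarith⟩
  have hd2 : Q ∣ q := hPQ.symm.dvd_of_dvd_mul_left ⟨b, by linarith⟩
  have hQ : Q = q := Int.dvd_antisymm (by omega) (by omega) hd2 hd1
  have hP : P = b := by
    rw [hQ] at h2
    exact (mul_right_cancel₀ (by exact_mod_cast hq.ne') h2).symm
  exact Prod.ext hP hQ

theorem continuousAt_cfTail {x : ℝ} {n : ℕ} (hx : CfLongerThan x n) :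
    ContinuousAt (fun y => cfTail y n) x := by
  induction n with
  | zero => exact continuousAt_id
  | succ n ih =>
    have h0 := hx n n.lt_succ_self
    have h1 := ih (hx.mono n.le_succ)
    have h2 : ContinuousAt (Int.fract : ℝ → ℝ) (cfTail x n) := by
      apply continuousAt_fract
      intro he
      rw [Int.fract] at h0
      exact h0 (sub_eq_zero.2 he)
    exact (ContinuousAt.comp (f := fun y => cfTail y n) h2 h1).inv₀ h0

theorem eventually_cfLongerThan {x : ℝ} {N : ℕ} (hx : CfLongerThan x N) :
    ∀ᶠ y in 𝓝 x, CfLongerThan y N ∧ ∀ i < N, cfb i y = cfb i x := by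
  have key : ∀ i < N, ∀ᶠ y in 𝓝 x, Int.fract (cfTail y i) ≠ 0 ∧ cfb i y = cfb i x := by
    intro i hi
    have h0 := hx i hi
    have hpos : 0 < Int.fract (cfTail x i) := lt_of_le_of_ne (Int.fract_nonneg _) h0.symm
    have hlt : (⌊cfTail x i⌋ : ℝ) < cfTail x i := by
      have := Int.floor_add_fract (cfTail x i); linarith
    have hcont := continuousAt_cfTail (hx.mono hi.le)
    filter_upwards [hcont.eventually_lt_const (Int.lt_floor_add_one (cfTail x i)),
      hcont.eventually_const_lt hlt] with y h1 h2
    have hfl : ⌊cfTail y i⌋ = ⌊cfTail x i⌋ := Int.floor_eq_iff.2 ⟨h2.le, h1⟩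
    refine ⟨?_, by rw [cfb_eq_floor_cfTail, cfb_eq_floor_cfTail, hfl]⟩
    rw [Int.fract, hfl]
    exact (sub_pos.2 h2).ne'
  have : ∀ᶠ y in 𝓝 x, ∀ i ∈ Finset.range N,
      Int.fract (cfTail y i) ≠ 0 ∧ cfb i y = cfb i x :=
    (Filter.eventually_all_finset _).2 fun i hi => key i (Finset.mem_range.1 hi)
  filter_upwards [this] with y hy
  exact ⟨fun i hi => (hy i (Finset.mem_range.2 hi)).1,
    fun i hi => (hy i (Finset.mem_range.2 hi)).2⟩

theorem isOpen_setOf_cfLongerThan (N : ℕ) : IsOpen {x : ℝ | CfLongerThan x N} :=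
  isOpen_iff_mem_nhds.2 fun _ hx => (eventually_cfLongerThan hx).mono fun _ hy => hy.1

theorem Irrational.cfTail {x : ℝ} (hx : Irrational x) (n : ℕ) : Irrational (cfTail x n) := by
  induction n with
  | zero => exact hx
  | succ n ih =>
    rw [_root_.cfTail, Int.fract]
    exact irrational_inv_iff.2 (ih.sub_intCast _)

theorem Irrational.cfLongerThan {x : ℝ} (hx : Irrational x) (N : ℕ) : CfLongerThan x N := by
  intro i _ h0
  apply (hx.cfTail i).ne_int ⌊_root_.cfTail x i⌋
  have := Int.floor_add_fract (_root_.cfTail x i)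
  linarith

theorem cfPQ_congr {x y : ℝ} {N : ℕ} (h : ∀ i ≤ N, cfb i y = cfb i x) :
    cfPQ y N = cfPQ x N := by
  induction N using Nat.twoStepInduction with
  | zero => simp [cfPQ, h 0]
  | one => simp [cfPQ, h 0, h 1]
  | more n ih1 ih2 =>
    simp only [cfPQ, h (n + 2) le_rfl, ih1 fun i hi => h i (by omega),
      ih2 fun i hi => h i (by omega)]

theorem den_cfConv {x : ℝ} {n : ℕ} (hx : CfLongerThan x (n + 1)) :
    ((cfConv x (n + 1)).den : ℤ) = (cfPQ x (n + 1)).2 ∧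
      (cfConv x (n + 1)).num = (cfPQ x (n + 1)).1 := by
  have h3 := one_le_cfPQ_snd hx
  have hdet := cfPQ_det x n
  have hPQ : IsCoprime (cfPQ x (n + 1)).1 (cfPQ x (n + 1)).2 := by
    refine ⟨(-1) ^ n * (cfPQ x n).2, -(-1) ^ n * (cfPQ x n).1, ?_⟩
    have : ((-1 : ℤ) ^ n) * (-1) ^ n = 1 := by rw [← mul_pow]; simp
    linear_combination (-1) ^ n * hdet + this
  have hc := Int.isCoprime_iff_gcd_eq_one.1 hPQ
  exact ⟨Rat.den_div_eq_of_coprime (by omega) hc, Rat.num_div_eq_of_coprime (by omega) hc⟩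

theorem ratBar_eq_div {y : ℚ} {a : ℤ} (ha1 : 1 ≤ a) (had : a ≤ y.den)
    (h : (y.den : ℤ) ∣ a * y.num - 1) : ratBar y = a / y.den := by
  have hmul : (a : ZMod y.den) * y.num = 1 := by
    have := (ZMod.intCast_zmod_eq_zero_iff_dvd (a * y.num - 1) y.den).2 h
    push_cast at this
    exact sub_eq_zero.1 this
  have hinv : (y.num : ZMod y.den)⁻¹ = a :=
    ZMod.inv_eq_of_mul_eq_one _ _ _ (by rw [mul_comm]; exact hmul)
  have : NeZero y.den := ⟨y.den_nz⟩
  have hval : ((((y.num : ZMod y.den)⁻¹).val : ℕ) : ℤ) = a % y.den := by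
    rw [hinv, ZMod.val_intCast]
  rw [ratBar]
  congr 1
  rcases had.lt_or_eq with hlt | heq
  · rw [Int.emod_eq_of_lt (by omega) hlt] at hval
    rw [if_neg (by omega)]
    exact_mod_cast congrArg (Int.cast : ℤ → ℚ) hval
  · rw [heq, Int.emod_self] at hval
    rw [if_pos (by exact_mod_cast hval), heq]
    simp

/-- For odd-index convergents, `ratBar` is a quotient of consecutive denominators. -/
theorem ratBar_cfConv {x : ℝ} {n : ℕ} (hn : Even n) (hx : CfLongerThan x (n + 1)) :
    ratBar (cfConv x (n + 1)) = (cfPQ x n).2 / (cfPQ x (n + 1)).2 := by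
  obtain ⟨hd, hnum⟩ := den_cfConv hx
  have hdet := cfPQ_det x n
  rw [hn.neg_one_pow] at hdet
  rw [ratBar_eq_div (a := (cfPQ x n).2) (one_le_cfPQ_snd (hx.mono n.le_succ))
    (by rw [hd]; exact cfPQ_snd_le hx)
    (by rw [hd, hnum]; exact ⟨(cfPQ x n).1, by linarith⟩), ← hd]
  simp

theorem apply_add_nat_of_pos {f : ℚ → ℂ} (hper : ∀ x : ℚ, x ∉ Set.Icc (-1 : ℚ) 0 → f (x + 1) = f x)
    {r : ℚ} (hr : 0 < r) (n : ℕ) : f (r + n) = f r := by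
  induction n with
  | zero => simp
  | succ n ih =>
    rw [← ih, ← hper (r + n) fun hmem => absurd hmem.2 (by push Not; positivity)]
    push_cast
    ring_nf

theorem apply_neg_add_nat_of_pos {f : ℚ → ℂ}
    (hper : ∀ x : ℚ, x ∉ Set.Icc (-1 : ℚ) 0 → f (x + 1) = f x)
    {r : ℚ} (hr : 0 < r) (n : ℕ) : f (-(r + n)) = f (-r) := by
  induction n with
  | zero => simp
  | succ n ih =>
    rw [← ih, ← hper (-(r + (n + 1 : ℕ))) fun hmem => absurd hmem.1 ?_]
    · push_cast
      ring_nf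
    · push_cast
      have : (0 : ℚ) ≤ n := n.cast_nonneg
      linarith

theorem apply_sign_mul_add_nat {f : ℚ → ℂ}
    (hper : ∀ x : ℚ, x ∉ Set.Icc (-1 : ℚ) 0 → f (x + 1) = f x)
    {r : ℚ} (hr : 0 < r) (n i : ℕ) : f ((-1) ^ i * (r + n)) = f ((-1) ^ i * r) := by
  rcases neg_one_pow_eq_or ℚ i with h | h
  · rw [h, one_mul, one_mul, apply_add_nat_of_pos hper hr]
  · rw [h, neg_one_mul, neg_one_mul, apply_neg_add_nat_of_pos hper hr]

theorem cpow_mul_apply_eq {k : ℂ} {f : ℚ → ℂ} {h : ℝ → ℂ}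
    (hrec : ∀ x : ℚ, x ≠ 0 → f x - ((|((x : ℚ) : ℝ)| : ℝ) : ℂ) ^ (-k) * f (-1 / x) = h x)
    {y : ℚ} {v w : ℝ} (hv : 0 < v) (hw : 0 < w) (hy : |(y : ℝ)| = v / w) :
    (w : ℂ) ^ (-k) * f y = (w : ℂ) ^ (-k) * h y + (v : ℂ) ^ (-k) * f (-1 / y) := by
  have hy0 : y ≠ 0 := by
    rintro rfl
    have : 0 < v / w := by positivity
    simp [← hy] at this
  have h1 := hrec y hy0
  rw [hy] at h1
  have h2 : (w : ℂ) ^ (-k) * ((v / w : ℝ) : ℂ) ^ (-k) = (v : ℂ) ^ (-k) := by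
    rw [← Complex.mul_cpow_ofReal_nonneg hw.le (by positivity), ← Complex.ofReal_mul,
      mul_div_cancel₀ _ hw.ne']
  rw [← h2, ← h1]
  ring

/-- The value `Q_{n+1}^{-k} f(± Q_n / Q_{n+1})` attached to consecutive denominators of
convergents of `x`. -/
noncomputable def cfValue (k : ℂ) (f : ℚ → ℂ) (x : ℝ) (n : ℕ) : ℂ :=
  (((cfPQ x (n + 1)).2 : ℝ) : ℂ) ^ (-k) *
    f ((-1) ^ n * (((cfPQ x n).2 : ℚ) / (cfPQ x (n + 1)).2))

theorem cfValue_succ {k : ℂ} {f : ℚ → ℂ} {h : ℝ → ℂ}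
    (hper : ∀ x : ℚ, x ∉ Set.Icc (-1 : ℚ) 0 → f (x + 1) = f x)
    (hrec : ∀ x : ℚ, x ≠ 0 → f x - ((|((x : ℚ) : ℝ)| : ℝ) : ℂ) ^ (-k) * f (-1 / x) = h x)
    {x : ℝ} {n : ℕ} (hx : CfLongerThan x (n + 2)) :
    cfValue k f x (n + 1) = (((cfPQ x (n + 2)).2 : ℝ) : ℂ) ^ (-k) *
      h ((-1) ^ (n + 1) * (((cfPQ x (n + 1)).2 : ℝ) / (cfPQ x (n + 2)).2)) +
        cfValue k f x n := by
  have h1 : 0 < (cfPQ x n).2 := one_le_cfPQ_snd (hx.mono (by omega))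
  have h2 : 0 < (cfPQ x (n + 1)).2 := one_le_cfPQ_snd (hx.mono (by omega))
  have h3 : 0 < (cfPQ x (n + 2)).2 := one_le_cfPQ_snd hx
  have hb : 1 ≤ cfb (n + 2) x := one_le_cfb hx
  have hrel : (cfPQ x (n + 2)).2 = cfb (n + 2) x * (cfPQ x (n + 1)).2 + (cfPQ x n).2 := rfl
  obtain ⟨a, ha⟩ := Int.eq_ofNat_of_zero_le (by omega : 0 ≤ cfb (n + 2) x)
  rw [ha] at hrel
  unfold cfValue
  generalize (cfPQ x n).2 = u at *
  generalize (cfPQ x (n + 1)).2 = v at *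
  generalize (cfPQ x (n + 2)).2 = w at *
  have h1q : (0 : ℚ) < u := by exact_mod_cast h1
  have h2q : (0 : ℚ) < v := by exact_mod_cast h2
  have h3q : (0 : ℚ) < w := by exact_mod_cast h3
  have h2r : (0 : ℝ) < v := by exact_mod_cast h2
  have h3r : (0 : ℝ) < w := by exact_mod_cast h3
  have hsq : ((-1 : ℚ) ^ n) * (-1) ^ n = 1 := by rw [← mul_pow]; simp
  have hy : |(((-1) ^ (n + 1) * ((v : ℚ) / w) : ℚ) : ℝ)| = (v : ℝ) / w := by
    push_cast
    rw [abs_mul, abs_pow, abs_neg, abs_one, one_pow, one_mul, abs_of_pos (by positivity)]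
  rw [cpow_mul_apply_eq hrec h2r h3r hy]
  congr 2
  · push_cast
    rfl
  · have : -1 / ((-1) ^ (n + 1) * ((v : ℚ) / w)) = (-1) ^ n * ((u : ℚ) / v + a) := by
      rw [hrel, pow_succ]
      have h4 : (0 : ℚ) < a * v + u := by positivity
      push_cast
      rw [div_eq_iff (by positivity)]
      field_simp
      linear_combination ((a : ℚ) * v + u) * hsq
    rw [this, apply_sign_mul_add_nat hper (by positivity)]

theorem exp_rpow_le_rpow {σ δ w : ℝ} {v : ℕ} (hσ : 0 < σ) (hδ1 : δ < 1) (hv : 2 ≤ v)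
    (hvw : (v : ℝ) ≤ w) (hw : approxThreshold (σ / 4) (1 - δ)⁻¹ v < w⁻¹) :
    Real.exp ((w / v) ^ (1 - δ)) ≤ w ^ (σ / 2) := by
  have hv2 : (2 : ℝ) ≤ v := by exact_mod_cast hv
  have hw0 : 0 < w := by linarith
  have hlog : 0 < Real.log (2 * v) := Real.log_pos (by linarith)
  have hl : 0 < σ / 4 * Real.log (2 * v) := by positivity
  have h1 : w / v ≤ (σ / 4 * Real.log (2 * v)) ^ (1 - δ)⁻¹ := by
    rw [approxThreshold, inv_lt_inv₀ (by positivity) hw0] at hw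
    rw [div_le_iff₀ (by linarith)]
    linarith
  have h2 : (w / v) ^ (1 - δ) ≤ σ / 4 * Real.log (2 * v) := by
    refine (Real.rpow_le_rpow (by positivity) h1 (by linarith)).trans ?_
    rw [← Real.rpow_mul hl.le, inv_mul_cancel₀ (by linarith), Real.rpow_one]
  have h3 : Real.log (2 * v) ≤ 2 * Real.log w := by
    have := Real.log_le_log (by linarith) (by nlinarith : 2 * (v : ℝ) ≤ w ^ 2)
    rwa [Real.log_pow] at this
  rw [Real.rpow_def_of_pos hw0, Real.exp_le_exp]
  nlinarith

theorem norm_cpow_mul_le {k : ℂ} {h : ℝ → ℂ} {δ C : ℝ} (hC : 0 ≤ C)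
    (hbound : ∀ x : ℝ, x ∈ Set.Ioo (-1 : ℝ) 1 → x ≠ 0 → ‖h x‖ ≤ C * Real.exp (|x| ^ (-1 + δ)))
    {y v w E : ℝ} (hv : 0 < v) (hvw : v < w) (hy : |y| = v / w)
    (hE : Real.exp ((w / v) ^ (1 - δ)) ≤ E) :
    ‖(w : ℂ) ^ (-k) * h y‖ ≤ C * (w ^ (-k.re) * E) := by
  have hw : 0 < w := hv.trans hvw
  have h1 : ‖h y‖ ≤ C * E := by
    refine (hbound y (abs_lt.1 ?_) ?_).trans ?_
    · rw [hy]
      exact (div_lt_one hw).2 hvw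
    · rw [← abs_pos, hy]
      positivity
    · have : |y| ^ (-1 + δ) = (w / v) ^ (1 - δ) := by
        rw [hy, ← inv_div, Real.inv_rpow (by positivity), ← Real.rpow_neg (by positivity)]
        ring_nf
      rw [this]
      gcongr
  rw [norm_mul, Complex.norm_cpow_eq_rpow_re_of_pos hw, Complex.neg_re]
  calc w ^ (-k.re) * ‖h y‖ ≤ w ^ (-k.re) * (C * E) := by gcongr
    _ = _ := by ring

theorem two_le_cfb_of_fract_eq_zero {x : ℝ} {n : ℕ} (hx : CfLongerThan x (n + 1))
    (h0 : Int.fract (cfTail x (n + 1)) = 0) : 2 ≤ cfb (n + 1) x := by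
  have h1 := cfTail_eq_add_fract x (n + 1)
  have h2 : 0 < Int.fract (cfTail x n) :=
    lt_of_le_of_ne (Int.fract_nonneg _) (hx n n.lt_succ_self).symm
  have h3 : 1 < cfTail x (n + 1) := (one_lt_inv₀ h2).2 (Int.fract_lt_one _)
  rw [h1, h0, add_zero] at h3
  exact_mod_cast h3

theorem norm_cfValue_sub_cfValue_le {k : ℂ} {f : ℚ → ℂ} {h : ℝ → ℂ}
    (hper : ∀ x : ℚ, x ∉ Set.Icc (-1 : ℚ) 0 → f (x + 1) = f x)
    (hrec : ∀ x : ℚ, x ≠ 0 → f x - ((|((x : ℚ) : ℝ)| : ℝ) : ℂ) ^ (-k) * f (-1 / x) = h x)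
    {δ C : ℝ} (hC : 0 ≤ C)
    (hbound : ∀ x : ℝ, x ∈ Set.Ioo (-1 : ℝ) 1 → x ≠ 0 → ‖h x‖ ≤ C * Real.exp (|x| ^ (-1 + δ)))
    {x : ℝ} {m n : ℕ} (hmn : m ≤ n) (hx : CfLongerThan x (n + 1))
    (hE : ∀ i, m ≤ i → i < n →
      Real.exp ((((cfPQ x (i + 2)).2 : ℝ) / (cfPQ x (i + 1)).2) ^ (1 - δ)) ≤
        ((cfPQ x (i + 2)).2 : ℝ) ^ (k.re / 2)) :
    ‖cfValue k f x n - cfValue k f x m‖ ≤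
      C * ∑ i ∈ Finset.Ico m n, ((cfPQ x (i + 2)).2 : ℝ) ^ (-(k.re / 2)) := by
  induction n, hmn using Nat.le_induction with
  | base => simp
  | succ n hmn ih =>
    have h1 := ih (hx.mono (by omega)) fun i hi hin => hE i hi (by omega)
    have hlt : ((cfPQ x (n + 1)).2 : ℝ) < (cfPQ x (n + 2)).2 := by exact_mod_cast cfPQ_snd_lt hx
    have hv : (0 : ℝ) < (cfPQ x (n + 1)).2 := by
      have : 0 < (cfPQ x (n + 1)).2 := one_le_cfPQ_snd (hx.mono (by omega))
      exact_mod_cast this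
    rw [Finset.sum_Ico_succ_top hmn, cfValue_succ hper hrec hx, mul_add, add_sub_assoc, add_comm]
    refine (norm_add_le _ _).trans (add_le_add h1 ?_)
    refine (norm_cpow_mul_le hC hbound hv hlt ?_ (hE n hmn n.lt_succ_self)).trans_eq ?_
    · rw [abs_mul, abs_pow, abs_neg, abs_one, one_pow, one_mul,
        abs_of_pos (div_pos hv (hv.trans hlt))]
    · rw [← Real.rpow_add (hv.trans hlt)]
      ring_nf

/-- If the expansion of `x` ends with the denominator `q = Q_{n+2}`, `n` even, then the value at
`1 - Q_{n+1} / q` is close to `cfValue k f x n`. -/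
theorem norm_cpow_mul_apply_one_sub_sub_cfValue_le {k : ℂ} (hk : 0 < k.re) {f : ℚ → ℂ} {h : ℝ → ℂ}
    (hper : ∀ x : ℚ, x ∉ Set.Icc (-1 : ℚ) 0 → f (x + 1) = f x)
    (hrec : ∀ x : ℚ, x ≠ 0 → f x - ((|((x : ℚ) : ℝ)| : ℝ) : ℂ) ^ (-k) * f (-1 / x) = h x)
    {δ C : ℝ} (hδ0 : 0 < δ) (hδ1 : δ < 1) (hC : 0 ≤ C)
    (hbound : ∀ x : ℝ, x ∈ Set.Ioo (-1 : ℝ) 1 → x ≠ 0 → ‖h x‖ ≤ C * Real.exp (|x| ^ (-1 + δ)))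
    {x : ℝ} {n : ℕ} (hn : Even n) (hx : CfLongerThan x (n + 2))
    (h0 : Int.fract (cfTail x (n + 2)) = 0)
    (hE : Real.exp ((((cfPQ x (n + 2)).2 : ℝ) / (cfPQ x (n + 1)).2) ^ (1 - δ)) ≤
        ((cfPQ x (n + 2)).2 : ℝ) ^ (k.re / 2)) :
    ‖(((cfPQ x (n + 2)).2 : ℝ) : ℂ) ^ (-k) *
        f ((((cfPQ x (n + 2)).2 - (cfPQ x (n + 1)).2 : ℤ) : ℚ) / (cfPQ x (n + 2)).2) -
      cfValue k f x n‖ ≤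
      C * (Real.exp 2 + 2 ^ k.re) * ((cfPQ x (n + 2)).2 : ℝ) ^ (-(k.re / 2)) := by
  have h1 : 0 < (cfPQ x n).2 := one_le_cfPQ_snd (hx.mono (by omega))
  have h2 : 0 < (cfPQ x (n + 1)).2 := one_le_cfPQ_snd (hx.mono (by omega))
  have hb : 2 ≤ cfb (n + 2) x := two_le_cfb_of_fract_eq_zero hx h0
  have hrel : (cfPQ x (n + 2)).2 = cfb (n + 2) x * (cfPQ x (n + 1)).2 + (cfPQ x n).2 := rfl
  obtain ⟨a, ha⟩ := Int.eq_ofNat_of_zero_le (by omega : 0 ≤ cfb (n + 2) x - 1)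
  rw [show cfb (n + 2) x = a + 1 by omega] at hrel
  have ha1 : 1 ≤ (a : ℤ) := by omega
  unfold cfValue
  rw [hn.neg_one_pow, one_mul]
  generalize (cfPQ x n).2 = u at *
  generalize (cfPQ x (n + 1)).2 = v at *
  generalize (cfPQ x (n + 2)).2 = w at *
  obtain ⟨t, ht⟩ : ∃ t, t = w - v := ⟨_, rfl⟩
  rw [← ht]
  have htuv : t = a * v + u := by rw [ht, hrel]; ring
  have hvt : v < t := by nlinarith
  have htw : t < w := by omega
  have hu0 : (0 : ℚ) < u := by exact_mod_cast h1
  have hv0 : (0 : ℚ) < v := by exact_mod_cast h2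
  have ht0 : (0 : ℚ) < t := by exact_mod_cast h2.trans hvt
  have hw0 : (0 : ℚ) < w := by exact_mod_cast (h2.trans hvt).trans htw
  have hv0r : (0 : ℝ) < v := by exact_mod_cast hv0
  have ht0r : (0 : ℝ) < t := by exact_mod_cast ht0
  have hw0r : (0 : ℝ) < w := by exact_mod_cast hw0
  have hvtr : (v : ℝ) < t := by exact_mod_cast hvt
  have htwr : (t : ℝ) < w := by exact_mod_cast htw
  have hwt : (w : ℝ) ≤ 2 * t := by
    have : w ≤ 2 * t := by omega
    exact_mod_cast this
  have hy1 : |(((t : ℚ) / w : ℚ) : ℝ)| = (t : ℝ) / w := by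
    push_cast
    exact abs_of_pos (by positivity)
  have hy2 : |((-((v : ℚ) / t) : ℚ) : ℝ)| = (v : ℝ) / t := by
    push_cast
    rw [abs_neg]
    exact abs_of_pos (by positivity)
  have e1 : f (-1 / ((t : ℚ) / w)) = f (-((v : ℚ) / t)) := by
    rw [← apply_neg_add_nat_of_pos hper (by positivity : 0 < (v : ℚ) / t) 1]
    congr 1
    have : (w : ℚ) = t + v := by rw [ht]; push_cast; ring
    rw [this]
    field_simp
    push_cast
    ring
  have e2 : f (-1 / (-((v : ℚ) / t))) = f ((u : ℚ) / v) := by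
    rw [← apply_add_nat_of_pos hper (by positivity : 0 < (u : ℚ) / v) a]
    congr 1
    rw [htuv]
    push_cast
    have : (0 : ℚ) < a * v + u := by positivity
    field_simp
    ring
  rw [cpow_mul_apply_eq hrec ht0r hw0r hy1, e1, cpow_mul_apply_eq hrec hv0r ht0r hy2, e2,
    ← add_assoc, add_sub_cancel_right]
  have hE1 : Real.exp (((w : ℝ) / t) ^ (1 - δ)) ≤ Real.exp 2 := by
    rw [Real.exp_le_exp]
    have hwt2 : (w : ℝ) / t ≤ 2 := (div_le_iff₀ ht0r).2 hwt
    have h1wt : 1 ≤ (w : ℝ) / t := (one_le_div ht0r).2 htwr.le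
    calc ((w : ℝ) / t) ^ (1 - δ) ≤ ((w : ℝ) / t) ^ (1 : ℝ) :=
          Real.rpow_le_rpow_of_exponent_le h1wt (by linarith)
      _ ≤ 2 := by rwa [Real.rpow_one]
  have hE2 : Real.exp (((t : ℝ) / v) ^ (1 - δ)) ≤ (w : ℝ) ^ (k.re / 2) := by
    refine le_trans ?_ hE
    rw [Real.exp_le_exp]
    exact Real.rpow_le_rpow (by positivity) (by gcongr) (by linarith)
  have hw1 : (1 : ℝ) ≤ w := by
    have : 1 ≤ w := by omega
    exact_mod_cast this
  have hwpow : (w : ℝ) ^ (-k.re) ≤ (w : ℝ) ^ (-(k.re / 2)) :=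
    Real.rpow_le_rpow_of_exponent_le hw1 (by linarith)
  have htpow : (t : ℝ) ^ (-k.re) ≤ 2 ^ k.re * (w : ℝ) ^ (-k.re) := by
    rw [Real.rpow_neg ht0r.le, Real.rpow_neg hw0r.le, ← div_eq_mul_inv,
      ← Real.div_rpow (by norm_num) hw0r.le, ← Real.inv_rpow ht0r.le]
    refine Real.rpow_le_rpow (by positivity) ?_ hk.le
    rw [inv_le_comm₀ ht0r (by positivity), inv_div]
    linarith
  have b1 := norm_cpow_mul_le (k := k) hC hbound ht0r htwr hy1 hE1
  have b2 := norm_cpow_mul_le (k := k) hC hbound hv0r hvtr hy2 hE2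
  refine (norm_add_le _ _).trans ((add_le_add b1 b2).trans ?_)
  have hsplit : (w : ℝ) ^ (-k.re) * (w : ℝ) ^ (k.re / 2) = (w : ℝ) ^ (-(k.re / 2)) := by
    rw [← Real.rpow_add hw0r]
    ring_nf
  calc C * ((w : ℝ) ^ (-k.re) * Real.exp 2) + C * ((t : ℝ) ^ (-k.re) * (w : ℝ) ^ (k.re / 2))
      ≤ C * ((w : ℝ) ^ (-(k.re / 2)) * Real.exp 2) +
        C * ((2 ^ k.re * (w : ℝ) ^ (-k.re)) * (w : ℝ) ^ (k.re / 2)) := by gcongr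
    _ = _ := by rw [mul_assoc (2 ^ k.re), hsplit]; ring

theorem eq_of_dvd_mul_sub_one {a a' b q : ℤ} (ha : 1 ≤ a) (haq : a ≤ q) (ha' : 1 ≤ a')
    (haq' : a' ≤ q) (h : q ∣ a * b - 1) (h' : q ∣ a' * b - 1) : a = a' := by
  have hc : IsCoprime q b := by
    obtain ⟨c, hc⟩ := h
    exact ⟨-c, a, by linarith⟩
  have hd : q ∣ a - a' := by
    refine hc.dvd_of_dvd_mul_right ?_
    have := dvd_sub h h'
    convert this using 1
    ring
  have := Int.eq_zero_of_abs_lt_dvd hd (abs_lt.2 ⟨by omega, by omega⟩)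
  omega

/-- Approximation of `q^{-k} f(a/q)` by the data of an odd-index convergent of `b / q`, where
`a * b ≡ 1 (mod q)`. -/
theorem norm_cpow_mul_apply_sub_cfValue_le {k : ℂ} (hk : 0 < k.re) {f : ℚ → ℂ} {h : ℝ → ℂ}
    (hper : ∀ x : ℚ, x ∉ Set.Icc (-1 : ℚ) 0 → f (x + 1) = f x)
    (hrec : ∀ x : ℚ, x ≠ 0 → f x - ((|((x : ℚ) : ℝ)| : ℝ) : ℂ) ^ (-k) * f (-1 / x) = h x)
    {δ C : ℝ} (hδ0 : 0 < δ) (hδ1 : δ < 1) (hC : 0 ≤ C)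
    (hbound : ∀ x : ℝ, x ∈ Set.Ioo (-1 : ℝ) 1 → x ≠ 0 → ‖h x‖ ≤ C * Real.exp (|x| ^ (-1 + δ)))
    {q a b m V : ℕ} (hVm : V ^ 2 ≤ 2 ^ m) (hV : 2 ≤ V)
    (hb : 1 ≤ b) (hbq : b ≤ q) (ha : 1 ≤ a) (haq : a ≤ q) (hab : (q : ℤ) ∣ a * b - 1)
    (hx : CfLongerThan ((b : ℝ) / q) (m + 2))
    (hgood : b ∉ (Finset.Ico V q).biUnion fun v =>
      nearMultiples q v (approxThreshold (k.re / 4) (1 - δ)⁻¹ v * q)) :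
    ‖((q : ℝ) : ℂ) ^ (-k) * f ((a : ℚ) / q) - cfValue k f ((b : ℝ) / q) m‖ ≤
      C * (Real.exp 2 + 2 ^ k.re) *
        (((2 : ℝ) ^ (-(k.re / 4))) ^ m / (1 - (2 : ℝ) ^ (-(k.re / 4)))) := by
  have hq : 0 < q := by omega
  have hqr : (0 : ℝ) < q := by exact_mod_cast hq
  have hcop : IsCoprime (b : ℤ) q := by
    obtain ⟨c, hc⟩ := hab
    exact ⟨a, -c, by linarith⟩
  obtain ⟨n, hxn, h0, hPQ⟩ := exists_cfPQ_eq (b : ℤ) q hq hcop (by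
    rw [Int.cast_natCast]
    exact hx.mono (by omega))
  rw [Int.cast_natCast] at hxn h0 hPQ
  set x : ℝ := (b : ℝ) / q with hxdef
  have hmn : m + 1 ≤ n := by
    by_contra hlt
    exact hx (n + 1) (by omega) h0
  have hQ : (cfPQ x (n + 1)).2 = q := by rw [hPQ]
  have hP : (cfPQ x (n + 1)).1 = b := by rw [hPQ]
  have hQrV : ∀ i, m ≤ i → i < n → (V : ℤ) ≤ (cfPQ x (i + 1)).2 := by
    intro i hi hin
    have hxi : CfLongerThan x (i + 1) := hxn.mono (by omega)
    have h1 := two_pow_le_cfPQ_snd_sq hxi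
    have h2 := one_le_cfPQ_snd hxi
    have h3 : (2 : ℤ) ^ m ≤ 2 ^ i := pow_le_pow_right₀ (by norm_num) hi
    have h4 : (V : ℤ) ^ 2 ≤ 2 ^ m := by exact_mod_cast hVm
    rw [pow_succ] at h1
    exact le_of_sq_le_sq (by nlinarith) (by omega)
  have hE : ∀ i, m ≤ i → i < n →
      Real.exp ((((cfPQ x (i + 2)).2 : ℝ) / (cfPQ x (i + 1)).2) ^ (1 - δ)) ≤
        ((cfPQ x (i + 2)).2 : ℝ) ^ (k.re / 2) := by
    intro i hi hin
    have hxi : CfLongerThan x (i + 2) := hxn.mono (by omega)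
    have h1 := hQrV i hi hin
    have h2 := cfPQ_snd_lt hxi
    have h3 : (cfPQ x (i + 2)).2 ≤ q := hQ ▸ cfPQ_snd_mono (by omega) hxn
    have h4 := abs_mul_cfPQ_sub_le hxi
    obtain ⟨v, hv⟩ := Int.eq_ofNat_of_zero_le (by omega : 0 ≤ (cfPQ x (i + 1)).2)
    rw [hv] at h1 h2 h4 ⊢
    have hvV : V ≤ v := by exact_mod_cast h1
    refine exp_rpow_le_rpow hk hδ1 (hV.trans hvV) (by exact_mod_cast h2.le) ?_
    by_contra! hle
    refine hgood (Finset.mem_biUnion.2 ⟨v, Finset.mem_Ico.2 ⟨hvV, by omega⟩,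
      mem_nearMultiples.2 ⟨⟨⟨hb, hbq⟩, ?_⟩, (cfPQ x (i + 1)).1, ?_⟩⟩)
    · exact Nat.isCoprime_iff_coprime.1 hcop
    · have h5 := h4.trans hle
      have h6 : (v : ℝ) * b - (cfPQ x (i + 1)).1 * q =
          (x * ((v : ℤ) : ℝ) - (cfPQ x (i + 1)).1) * q := by
        rw [hxdef, Int.cast_natCast]
        field_simp
      rw [h6, abs_mul, abs_of_pos hqr]
      gcongr
  set K := C * (Real.exp 2 + 2 ^ k.re) with hK
  have hCK : C ≤ K := by
    have h1 : 1 ≤ Real.exp 2 := Real.one_le_exp (by norm_num)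
    have h2 : (0 : ℝ) ≤ 2 ^ k.re := by positivity
    nlinarith
  set ρ : ℝ := (2 : ℝ) ^ (-(k.re / 4)) with hρ
  have hρ0 : 0 < ρ := by positivity
  have hρ1 : ρ < 1 := Real.rpow_lt_one_of_one_lt_of_neg (by norm_num) (by linarith)
  have hsum : ∑ i ∈ Finset.Ico m n, ((cfPQ x (i + 2)).2 : ℝ) ^ (-(k.re / 2)) ≤
      ρ ^ m / (1 - ρ) := by
    calc ∑ i ∈ Finset.Ico m n, ((cfPQ x (i + 2)).2 : ℝ) ^ (-(k.re / 2))
        ≤ ∑ i ∈ Finset.Ico m n, ρ ^ i := by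
          refine Finset.sum_le_sum fun i hi => ?_
          obtain ⟨_, hin⟩ := Finset.mem_Ico.1 hi
          have hxi : CfLongerThan x (i + 2) := hxn.mono (by omega)
          have h1 := two_pow_le_cfPQ_snd_sq hxi
          have h2 := one_le_cfPQ_snd hxi
          rw [pow_add] at h1
          have h3 : (2 : ℤ) ^ i ≤ (cfPQ x (i + 2)).2 ^ 2 := by
            have : (0 : ℤ) < 2 ^ i := by positivity
            linarith
          have h3r : (2 : ℝ) ^ i ≤ ((cfPQ x (i + 2)).2 : ℝ) ^ 2 := by exact_mod_cast h3
          have h2r : (0 : ℝ) < (cfPQ x (i + 2)).2 := by exact_mod_cast h2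
          calc ((cfPQ x (i + 2)).2 : ℝ) ^ (-(k.re / 2))
              = (((cfPQ x (i + 2)).2 : ℝ) ^ 2) ^ (-(k.re / 4)) := by
                rw [← Real.rpow_natCast, ← Real.rpow_mul h2r.le]
                congr 1
                push_cast
                ring
            _ ≤ ((2 : ℝ) ^ i) ^ (-(k.re / 4)) :=
                Real.rpow_le_rpow_of_nonpos (by positivity) h3r (by linarith)
            _ = ρ ^ i := by
                rw [hρ, ← Real.rpow_natCast, ← Real.rpow_natCast, ← Real.rpow_mul (by norm_num),
                  ← Real.rpow_mul (by norm_num), mul_comm]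
      _ ≤ ρ ^ m / (1 - ρ) := geom_sum_Ico_le_of_lt_one hρ0.le hρ1
  refine le_trans ?_ (mul_le_mul_of_nonneg_left hsum (by positivity))
  have hterm0 : ∀ i ∈ Finset.Ico m n, 0 ≤ ((cfPQ x (i + 2)).2 : ℝ) ^ (-(k.re / 2)) := by
    intro i hi
    have h2 := one_le_cfPQ_snd (hxn.mono (by have := Finset.mem_Ico.1 hi; omega) :
      CfLongerThan x (i + 2))
    have h2r : (0 : ℝ) < (cfPQ x (i + 2)).2 := by exact_mod_cast h2
    positivity
  have hdet := cfPQ_det x n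
  rw [hP, hQ] at hdet
  have hQn := one_le_cfPQ_snd (hxn.mono n.le_succ)
  have hQnq : (cfPQ x n).2 ≤ q := hQ ▸ cfPQ_snd_le hxn
  rcases Nat.even_or_odd n with hn | hn
  · rw [hn.neg_one_pow] at hdet
    have haQ : (a : ℤ) = (cfPQ x n).2 :=
      eq_of_dvd_mul_sub_one (b := b) (q := q) (by omega) (by omega) hQn hQnq hab
        ⟨(cfPQ x n).1, by linarith⟩
    have hval : ((q : ℝ) : ℂ) ^ (-k) * f ((a : ℚ) / q) = cfValue k f x n := by
      rw [cfValue, hQ, ← haQ, hn.neg_one_pow, one_mul]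
      simp
    rw [hval]
    refine (norm_cfValue_sub_cfValue_le hper hrec hC hbound (by omega) hxn hE).trans ?_
    exact mul_le_mul_of_nonneg_right hCK (Finset.sum_nonneg hterm0)
  · obtain ⟨n, rfl⟩ : ∃ l, n = l + 1 := ⟨n - 1, by omega⟩
    rw [hn.neg_one_pow] at hdet
    have hn' : Even n := by
      rw [← Nat.not_odd_iff_even]
      intro ho
      exact (Nat.not_even_iff_odd.2 hn) ho.add_one
    have hlt : (cfPQ x (n + 1)).2 < q := hQ ▸ cfPQ_snd_lt hxn
    have haQ : (a : ℤ) = q - (cfPQ x (n + 1)).2 :=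
      eq_of_dvd_mul_sub_one (b := b) (q := q) (by omega) (by omega) (by omega) (by omega) hab
        ⟨b - (cfPQ x (n + 1)).1, by linear_combination -hdet⟩
    have hlast := norm_cpow_mul_apply_one_sub_sub_cfValue_le hk hper hrec hδ0 hδ1 hC hbound hn'
      hxn h0 (hE n (by omega) (by omega))
    rw [hQ, ← haQ] at hlast
    have hfirst := norm_cfValue_sub_cfValue_le hper hrec hC hbound (by omega : m ≤ n)
      (hxn.mono (by omega)) fun i hi hin => hE i hi (by omega)
    rw [Finset.sum_Ico_succ_top (by omega), mul_add, hQ]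
    have hCK' := mul_le_mul_of_nonneg_right hCK (Finset.sum_nonneg fun i hi => hterm0 i
      (Finset.Ico_subset_Ico_right n.le_succ hi) :
        0 ≤ ∑ i ∈ Finset.Ico m n, ((cfPQ x (i + 2)).2 : ℝ) ^ (-(k.re / 2)))
    simp only [Int.cast_natCast] at hlast ⊢
    refine (norm_sub_le_norm_sub_add_norm_sub _ (cfValue k f x n) _).trans ?_
    linarith

theorem continuousAt_cfValue (k : ℂ) (f : ℚ → ℂ) {x : ℝ} {m : ℕ} (hx : CfLongerThan x (m + 2)) :
    ContinuousAt (fun y => cfValue k f y m) x := by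
  refine (continuousAt_const (y := cfValue k f x m)).congr ?_
  filter_upwards [eventually_cfLongerThan hx] with y hy
  have h1 : cfPQ y m = cfPQ x m := cfPQ_congr fun i hi => hy.2 i (by omega)
  have h2 : cfPQ y (m + 1) = cfPQ x (m + 1) := cfPQ_congr fun i hi => hy.2 i (by omega)
  rw [cfValue, cfValue, h1, h2]

theorem cfValue_eq_of_even (k : ℂ) (f : ℚ → ℂ) {x : ℝ} {n : ℕ} (hn : Even n)
    (hx : CfLongerThan x (n + 1)) :
    cfValue k f x n =
      (((cfConv x (n + 1)).den : ℝ) : ℂ) ^ (-k) * f (ratBar (cfConv x (n + 1))) := by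
  have h1 : (((cfPQ x (n + 1)).2 : ℤ) : ℝ) = (cfConv x (n + 1)).den := by
    rw [← (den_cfConv hx).1, Int.cast_natCast]
  rw [ratBar_cfConv hn hx, cfValue, hn.neg_one_pow, one_mul, h1]

theorem ae_cfLongerThan : ∀ᵐ x : ℝ, ∀ N, CfLongerThan x N := by
  have h : ∀ᵐ x : ℝ, Irrational x := by
    rw [ae_iff]
    simpa only [Irrational, not_not, ofPred_mem_eq] using
      (countable_range ((↑) : ℚ → ℝ)).measure_zero volume
  filter_upwards [h] with x hx N using hx.cfLongerThan N

/-- Urysohn cutoff for an open set of full measure. -/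
theorem exists_continuous_tsupport_subset_integral_gt {U : Set ℝ} (hU : IsOpen U)
    (hfull : ∀ᵐ x : ℝ, x ∈ U) {η : ℝ} (hη : 0 < η) :
    ∃ χ : C(ℝ, ℝ), tsupport χ ⊆ U ∧ (∀ x, χ x ∈ Set.Icc (0 : ℝ) 1) ∧
      1 - η < ∫ x in Set.Icc (0 : ℝ) 1, χ x := by
  set μ : Measure ℝ := volume.restrict (Set.Icc 0 1) with hμ
  have hμ1 : μ univ = 1 := by simp [hμ]
  have hμU : μ U = 1 := by
    rw [← hμ1]
    exact measure_congr (eventuallyEq_univ.2 (ae_restrict_of_ae hfull))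
  obtain ⟨K, hKU, hK, hμK⟩ := hU.exists_lt_isCompact (μ := μ)
    (r := ENNReal.ofReal (1 - η)) (by
      rw [hμU, ENNReal.ofReal_lt_one]
      linarith)
  obtain ⟨χ, hχ1, -, hχU, hχ01⟩ := exists_continuousMap_one_of_isCompact_subset_isOpen hK hU hKU
  refine ⟨χ, hχU, hχ01, ?_⟩
  have hKreal : 1 - η < μ.real K := by
    by_contra! hle
    refine hμK.not_ge ?_
    rw [← ofReal_measureReal]
    exact ENNReal.ofReal_le_ofReal hle
  refine hKreal.trans_le ?_
  have hint : Integrable χ μ :=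
    Integrable.of_bound χ.continuous.aestronglyMeasurable 1 (ae_of_all _ fun x => by
      rw [Real.norm_of_nonneg (hχ01 x).1]
      exact (hχ01 x).2)
  calc μ.real K = ∫ x, K.indicator 1 x ∂μ := (integral_indicator_one hK.measurableSet).symm
    _ ≤ ∫ x, χ x ∂μ := by
      refine integral_mono ((integrable_const (1 : ℝ)).indicator hK.measurableSet) hint fun x => ?_
      by_cases hx : x ∈ K
      · simp [hx, hχ1 hx]
      · simpa [hx] using (hχ01 x).1

/-- The inverse of `b` modulo `q`. -/
def invMod (q b : ℕ) : ℕ := ((b : ZMod q)⁻¹).val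

theorem invMod_spec {q b : ℕ} (hq : 2 ≤ q) (hb : b.Coprime q) :
    1 ≤ invMod q b ∧ invMod q b ≤ q ∧ (q : ℤ) ∣ invMod q b * b - 1 := by
  have : NeZero q := ⟨by omega⟩
  have hdvd : (q : ℤ) ∣ invMod q b * b - 1 := by
    rw [← ZMod.intCast_zmod_eq_zero_iff_dvd, invMod]
    push_cast
    rw [ZMod.natCast_zmod_val, mul_comm, ZMod.coe_mul_inv_eq_one b hb, sub_self]
  refine ⟨?_, (ZMod.val_lt _).le, hdvd⟩
  by_contra! h0
  have h1 : invMod q b = 0 := by omega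
  rw [h1] at hdvd
  have h2 : (q : ℤ) ∣ 1 := by
    rw [← dvd_neg]
    simpa using hdvd
  have := Int.le_of_dvd one_pos h2
  omega

theorem coprime_invMod {q b : ℕ} (hq : 2 ≤ q) (hb : b.Coprime q) : (invMod q b).Coprime q := by
  obtain ⟨c, hc⟩ := (invMod_spec hq hb).2.2
  exact Nat.isCoprime_iff_coprime.1 ⟨b, -c, by linarith⟩

theorem sum_coprime_invMod {q : ℕ} (hq : 2 ≤ q) (φ : ℕ → ℝ) :
    ∑ b ∈ (Finset.Icc 1 q).filter (fun a => Nat.Coprime a q), φ (invMod q b) =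
      ∑ a ∈ (Finset.Icc 1 q).filter (fun a => Nat.Coprime a q), φ a := by
  have hmem : ∀ b ∈ (Finset.Icc 1 q).filter (fun a => Nat.Coprime a q),
      invMod q b ∈ (Finset.Icc 1 q).filter (fun a => Nat.Coprime a q) := by
    intro b hb
    have hc := (Finset.mem_filter.1 hb).2
    obtain ⟨h1, h2, -⟩ := invMod_spec hq hc
    exact Finset.mem_filter.2 ⟨Finset.mem_Icc.2 ⟨h1, h2⟩, coprime_invMod hq hc⟩
  have hinv : ∀ b ∈ (Finset.Icc 1 q).filter (fun a => Nat.Coprime a q),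
      invMod q (invMod q b) = b := by
    intro b hb
    obtain ⟨hb1, hc⟩ := Finset.mem_filter.1 hb
    obtain ⟨hb1, hbq⟩ := Finset.mem_Icc.1 hb1
    obtain ⟨-, -, h3⟩ := invMod_spec hq hc
    obtain ⟨h4, h5, h6⟩ := invMod_spec hq (coprime_invMod hq hc)
    have := eq_of_dvd_mul_sub_one (a := invMod q (invMod q b)) (a' := b) (b := invMod q b) (q := q)
      (by omega) (by omega) (by omega) (by omega) h6 (by rwa [mul_comm])
    exact_mod_cast this
  exact Finset.sum_nbij' (invMod q) (invMod q) hmem hmem hinv hinv fun _ _ => rfl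

theorem tendsto_integral_comp_cfValue {k : ℂ} {f : ℚ → ℂ} {X : Set ℝ} (hX : volume Xᶜ = 0)
    {F : ℝ → ℂ} (hF : ∀ x ∈ X, Tendsto
      (fun j : ℕ => (((cfConv x (2 * j + 1)).den : ℝ) : ℂ) ^ (-k)
        * f (ratBar (cfConv x (2 * j + 1)))) atTop (𝓝 (F x)))
    {G : ℂ → ℝ} (hG : Continuous G) {M : ℝ} (hM : ∀ z, |G z| ≤ M) :
    (∀ m, AEStronglyMeasurable (fun x => G (cfValue k f x m)) volume) ∧
    Tendsto (fun j : ℕ => ∫ x in Set.Icc (0 : ℝ) 1, G (cfValue k f x (2 * j))) atTop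
      (𝓝 (∫ x in Set.Icc (0 : ℝ) 1, G (F x))) := by
  have hmeas : ∀ m, AEStronglyMeasurable (fun x => G (cfValue k f x m)) volume := by
    intro m
    have hcont : ContinuousOn (fun x => G (cfValue k f x m)) {x | CfLongerThan x (m + 2)} :=
      fun x hx => (hG.continuousAt.comp (continuousAt_cfValue k f hx)).continuousWithinAt
    have h := hcont.aestronglyMeasurable (μ := volume)
      (isOpen_setOf_cfLongerThan (m + 2)).measurableSet
    have hae : ∀ᵐ x : ℝ, x ∈ {x : ℝ | CfLongerThan x (m + 2)} :=
      ae_cfLongerThan.mono fun x hx => hx _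
    rwa [Measure.restrict_eq_self_of_ae_mem hae] at h
  refine ⟨hmeas, tendsto_integral_of_dominated_convergence (fun _ => M)
    (fun j => (hmeas _).restrict) (integrable_const M) (fun j => ae_of_all _ fun x => hM _) ?_⟩
  refine ae_restrict_of_ae ?_
  have hXae : ∀ᵐ x : ℝ, x ∈ X := mem_ae_iff.2 hX
  filter_upwards [ae_cfLongerThan, hXae] with x hx hxX
  refine (hG.tendsto _).comp ((hF x hxX).congr fun j => ?_)
  rw [cfValue_eq_of_even k f (even_two_mul j) (hx _)]

/-- The average of `φ` over the reduced residues modulo `q`. -/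
noncomputable def coprimeAverage (q : ℕ) (φ : ℕ → ℝ) : ℝ :=
  (∑ a ∈ (Finset.Icc 1 q).filter fun a => Nat.Coprime a q, φ a) / (q.totient : ℝ)

theorem card_filter_coprime_Icc (q : ℕ) :
    ((Finset.Icc 1 q).filter fun a => Nat.Coprime a q).card = q.totient := by
  rw [← card_coprime_Ioc_self q]
  rfl

theorem tendsto_coprimeAverage_of_lipschitz {k : ℂ} (hk : 0 < k.re) {f : ℚ → ℂ} {h : ℝ → ℂ}
    (hper : ∀ x : ℚ, x ∉ Set.Icc (-1 : ℚ) 0 → f (x + 1) = f x)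
    (hrec : ∀ x : ℚ, x ≠ 0 → f x - ((|((x : ℚ) : ℝ)| : ℝ) : ℂ) ^ (-k) * f (-1 / x) = h x)
    {δ C : ℝ} (hδ0 : 0 < δ) (hδ1 : δ < 1) (hC : 0 ≤ C)
    (hbound : ∀ x : ℝ, x ∈ Set.Ioo (-1 : ℝ) 1 → x ≠ 0 → ‖h x‖ ≤ C * Real.exp (|x| ^ (-1 + δ)))
    {X : Set ℝ} (hX : volume Xᶜ = 0)
    {F : ℝ → ℂ} (hF : ∀ x ∈ X, Tendsto
      (fun j : ℕ => (((cfConv x (2 * j + 1)).den : ℝ) : ℂ) ^ (-k)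
        * f (ratBar (cfConv x (2 * j + 1)))) atTop (𝓝 (F x)))
    {G : ℂ → ℝ} {L : NNReal} (hL : LipschitzWith L G) {M : ℝ} (hM : ∀ z, |G z| ≤ M) :
    Tendsto (fun q : ℕ => coprimeAverage q fun a => G (((q : ℝ) : ℂ) ^ (-k) * f ((a : ℚ) / q)))
      atTop (𝓝 (∫ x in Set.Icc (0 : ℝ) 1, G (F x))) := by
  have hM0 : 0 ≤ M := (abs_nonneg _).trans (hM 0)
  obtain ⟨hmeas, hlim⟩ := tendsto_integral_comp_cfValue hX hF hL.continuous hM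
  rw [Metric.tendsto_nhds]
  intro ε hε
  set η : ℝ := ε / (16 * (M + 1)) with hηdef
  have hη : 0 < η := by positivity
  have hMη : M * η ≤ ε / 16 := by
    rw [hηdef, mul_div_assoc', div_le_div_iff₀ (by positivity) (by norm_num)]
    nlinarith
  have hβ : 1 + 2 * (((1 - δ)⁻¹ - 1) / 2) = (1 - δ)⁻¹ := by ring
  have hβ1 : 1 < (1 - δ)⁻¹ := (one_lt_inv₀ (by linarith)).2 (by linarith)
  obtain ⟨V₀, hV₀⟩ := exists_eventually_card_biUnion_nearMultiples_le (k.re / 4)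
    (((1 - δ)⁻¹ - 1) / 2) η (by positivity) (by linarith) hη
  rw [hβ] at hV₀
  set V := max V₀ 2 with hVdef
  set bad : ℕ → Finset ℕ := fun q => (Finset.Ico V q).biUnion fun v =>
    nearMultiples q v (approxThreshold (k.re / 4) (1 - δ)⁻¹ v * q) with hbad
  have hbadle : ∀ᶠ q : ℕ in atTop, ((bad q).card : ℝ) ≤ η * q.totient := by
    filter_upwards [hV₀] with q hq
    refine le_trans ?_ hq
    exact_mod_cast Finset.card_le_card (Finset.biUnion_subset_biUnion_of_subset_left _
      (Finset.Ico_subset_Ico_left (le_max_left _ _)))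
  set ρ : ℝ := (2 : ℝ) ^ (-(k.re / 4)) with hρ
  have hρ0 : 0 < ρ := by positivity
  have hρ1 : ρ < 1 := Real.rpow_lt_one_of_one_lt_of_neg (by norm_num) (by linarith)
  have hsmall : Tendsto (fun m : ℕ => L * (C * (Real.exp 2 + 2 ^ k.re) * (ρ ^ m / (1 - ρ))))
      atTop (𝓝 0) := by
    have := (((tendsto_pow_atTop_nhds_zero_of_lt_one hρ0.le hρ1).div_const (1 - ρ)).const_mul
      (C * (Real.exp 2 + 2 ^ k.re))).const_mul (L : ℝ)
    simpa using this
  have h2j : Tendsto (fun j : ℕ => 2 * j) atTop atTop :=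
    tendsto_atTop_mono (fun j => by simp only [id]; omega) tendsto_id
  have hpow : ∀ᶠ m : ℕ in atTop, V ^ 2 ≤ 2 ^ m :=
    (tendsto_pow_atTop_atTop_of_one_lt (one_lt_two : (1 : ℕ) < 2)).eventually_ge_atTop _
  obtain ⟨j, ⟨hj1, hj2⟩, hj3⟩ := (((h2j.eventually hpow).and
    (h2j.eventually (hsmall.eventually_lt_const (by positivity : 0 < ε / 16)))).and
    (Metric.tendsto_nhds.1 hlim (ε / 16) (by positivity))).exists
  set m := 2 * j
  set g : ℝ → ℝ := fun x => G (cfValue k f x m) with hg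
  obtain ⟨ε', hε'⟩ : ∃ e : ℝ, e = L * (C * (Real.exp 2 + 2 ^ k.re) * (ρ ^ m / (1 - ρ))) := ⟨_, rfl⟩
  rw [← hε'] at hj2
  obtain ⟨χ, hχU, hχ01, hχint⟩ := exists_continuous_tsupport_subset_integral_gt
    (isOpen_setOf_cfLongerThan (m + 2)) (ae_cfLongerThan.mono fun x hx => hx _) hη
  have hχg : Continuous fun x => χ x * g x := by
    refine ContinuousOn.continuous_of_tsupport_subset (s := {x | CfLongerThan x (m + 2)}) ?_
      (isOpen_setOf_cfLongerThan (m + 2)) ((tsupport_mul_subset_left).trans hχU)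
    exact χ.continuous.continuousOn.mul fun x hx =>
      (hL.continuous.continuousAt.comp (continuousAt_cfValue k f hx)).continuousWithinAt
  have hav1 := Metric.tendsto_nhds.1 (tendsto_sum_coprime_div_totient _ hχg) (ε / 16)
    (by positivity)
  have hav2 := Metric.tendsto_nhds.1 (tendsto_sum_coprime_div_totient _ χ.continuous) η hη
  have hint : |(∫ x in Set.Icc (0 : ℝ) 1, χ x * g x) - ∫ x in Set.Icc (0 : ℝ) 1, g x| ≤ M * η := by
    have hχi : Integrable χ (volume.restrict (Set.Icc (0 : ℝ) 1)) :=
      χ.continuous.integrableOn_Icc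
    have hgi : Integrable g (volume.restrict (Set.Icc (0 : ℝ) 1)) :=
      Integrable.of_bound (hmeas m).restrict M (ae_of_all _ fun x => hM _)
    rw [← integral_sub hχg.integrableOn_Icc hgi, ← Real.norm_eq_abs]
    calc ‖∫ x in Set.Icc (0 : ℝ) 1, (χ x * g x - g x)‖
        ≤ ∫ x in Set.Icc (0 : ℝ) 1, M * (1 - χ x) := by
          refine norm_integral_le_of_norm_le (((integrable_const (1 : ℝ)).sub hχi).const_mul M)
            (ae_of_all _ fun x => ?_)
          rw [show χ x * g x - g x = -(g x * (1 - χ x)) by ring, norm_neg, norm_mul,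
            Real.norm_of_nonneg (sub_nonneg.2 (hχ01 x).2)]
          exact mul_le_mul_of_nonneg_right (hM _) (sub_nonneg.2 (hχ01 x).2)
      _ = M * (1 - ∫ x in Set.Icc (0 : ℝ) 1, χ x) := by
          rw [integral_const_mul, integral_sub (integrable_const _) hχi]
          simp
      _ ≤ M * η := by gcongr; linarith
  filter_upwards [hav1, hav2, hbadle, eventually_ge_atTop 2] with q h1 h2 h3 hq2
  have hφ : (0 : ℝ) < q.totient := by exact_mod_cast Nat.totient_pos.2 (by omega)
  set s := (Finset.Icc 1 q).filter fun a => Nat.Coprime a q with hs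
  have hscard : (s.card : ℝ) = q.totient := by exact_mod_cast card_filter_coprime_Icc q
  have hpt : ∀ b ∈ s, |G (((q : ℝ) : ℂ) ^ (-k) * f ((invMod q b : ℚ) / q)) -
      χ ((b : ℝ) / q) * g ((b : ℝ) / q)| ≤
      ε' + M * (1 - χ ((b : ℝ) / q)) + 2 * M * (if b ∈ bad q then 1 else 0) := by
    intro b hb
    have hε'0 : 0 ≤ ε' := by
      have : 0 < 1 - ρ := by linarith
      rw [hε']
      positivity
    obtain ⟨hb1, hc⟩ := Finset.mem_filter.1 hb
    obtain ⟨hb1, hbq⟩ := Finset.mem_Icc.1 hb1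
    obtain ⟨i1, i2, i3⟩ := invMod_spec hq2 hc
    set Φ := G (((q : ℝ) : ℂ) ^ (-k) * f ((invMod q b : ℚ) / q)) with hΦ
    have hΦM : |Φ| ≤ M := hM _
    have hgM : |g ((b : ℝ) / q)| ≤ M := hM _
    obtain ⟨hχ0, hχ1⟩ := hχ01 ((b : ℝ) / q)
    have hχM : 0 ≤ M * (1 - χ ((b : ℝ) / q)) := mul_nonneg hM0 (by linarith)
    by_cases hbb : b ∈ bad q
    · rw [if_pos hbb]
      have : |χ ((b : ℝ) / q) * g ((b : ℝ) / q)| ≤ M := by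
        rw [abs_mul, abs_of_nonneg hχ0]
        nlinarith [abs_nonneg (g ((b : ℝ) / q))]
      refine (abs_sub _ _).trans ?_
      linarith
    · rw [if_neg hbb]
      by_cases hlong : CfLongerThan ((b : ℝ) / q) (m + 2)
      · have happ := norm_cpow_mul_apply_sub_cfValue_le hk hper hrec hδ0 hδ1 hC hbound hj1
          (le_max_right _ _) hb1 hbq i1 i2 i3 hlong hbb
        have hΦg : |Φ - g ((b : ℝ) / q)| ≤ ε' := by
          rw [← Real.dist_eq]
          refine (hL.dist_le_mul _ _).trans ?_
          rw [dist_eq_norm, hε']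
          exact mul_le_mul_of_nonneg_left happ L.coe_nonneg
        rw [show Φ - χ ((b : ℝ) / q) * g ((b : ℝ) / q) = (Φ - g ((b : ℝ) / q)) +
          g ((b : ℝ) / q) * (1 - χ ((b : ℝ) / q)) by ring]
        refine (abs_add_le _ _).trans ?_
        rw [abs_mul, abs_of_nonneg (sub_nonneg.2 hχ1)]
        have := mul_le_mul_of_nonneg_right hgM (sub_nonneg.2 hχ1)
        linarith
      · have hz : χ ((b : ℝ) / q) = 0 := image_eq_zero_of_notMem_tsupport fun hmem =>
          hlong (hχU hmem)
        rw [hz, zero_mul, sub_zero]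
        linarith
  have hcmp : |coprimeAverage q (fun a => G (((q : ℝ) : ℂ) ^ (-k) * f ((a : ℚ) / q))) -
      (∑ b ∈ s, χ ((b : ℝ) / q) * g ((b : ℝ) / q)) / q.totient| ≤
      ε' + M * (1 - (∑ b ∈ s, χ ((b : ℝ) / q)) / q.totient) + 2 * M * η := by
    rw [coprimeAverage, ← sum_coprime_invMod hq2 fun a =>
      G (((q : ℝ) : ℂ) ^ (-k) * f ((a : ℚ) / q)), ← sub_div, ← Finset.sum_sub_distrib, abs_div,
      abs_of_pos hφ, div_le_iff₀ hφ]
    refine (Finset.abs_sum_le_sum_abs _ _).trans ((Finset.sum_le_sum hpt).trans ?_)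
    rw [Finset.sum_add_distrib, Finset.sum_add_distrib, ← Finset.mul_sum, ← Finset.mul_sum,
      Finset.sum_sub_distrib, Finset.sum_const, Finset.sum_const, nsmul_eq_mul, nsmul_eq_mul,
      hscard, Finset.sum_ite_mem, Finset.sum_const, nsmul_eq_mul, mul_one]
    have hcard : ((s ∩ bad q).card : ℝ) ≤ η * q.totient := by
      refine le_trans ?_ h3
      exact_mod_cast Finset.card_le_card Finset.inter_subset_right
    have := mul_le_mul_of_nonneg_left hcard (by positivity : 0 ≤ 2 * M)
    have hdiv : (1 - (∑ b ∈ s, χ ((b : ℝ) / q)) / q.totient) * q.totient =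
        q.totient - ∑ b ∈ s, χ ((b : ℝ) / q) := by
      field_simp
    calc _ ≤ q.totient * ε' + M * ((1 - (∑ b ∈ s, χ ((b : ℝ) / q)) / q.totient) * q.totient) +
          2 * M * (η * q.totient) := by
          rw [hdiv]
          linarith
      _ = _ := by ring
  rw [Real.dist_eq] at h1 h2 hj3 ⊢
  have h4 : M * (1 - (∑ b ∈ s, χ ((b : ℝ) / q)) / q.totient) ≤ M * (2 * η) := by
    gcongr
    linarith [(abs_lt.1 h2).1]
  rw [abs_lt] at h1 hj3 ⊢
  rw [abs_le] at hcmp hint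
  constructor <;> linarith

/-- The uniform distribution on the values `z a`, where `a` runs over the reduced residues
modulo `q`. -/
noncomputable def coprimeMeasure (q : ℕ) (z : ℕ → ℂ) : Measure ℂ :=
  ∑ a ∈ (Finset.Icc 1 q).filter fun a => Nat.Coprime a q,
    (q.totient : ENNReal)⁻¹ • Measure.dirac (z a)

theorem isProbabilityMeasure_coprimeMeasure {q : ℕ} (hq : 0 < q) (z : ℕ → ℂ) :
    IsProbabilityMeasure (coprimeMeasure q z) := by
  refine ⟨?_⟩
  have hφ : (q.totient : ENNReal) ≠ 0 := by exact_mod_cast (Nat.totient_pos.2 hq).ne'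
  simp only [coprimeMeasure, Measure.finsetSum_apply, Measure.smul_apply, measure_univ,
    Finset.sum_const, card_filter_coprime_Icc, nsmul_eq_mul, smul_eq_mul, mul_one]
  exact ENNReal.mul_inv_cancel hφ (ENNReal.natCast_ne_top _)

theorem integral_coprimeMeasure {q : ℕ} (hq : 0 < q) (z : ℕ → ℂ) (G : ℂ → ℝ) :
    ∫ w, G w ∂coprimeMeasure q z = coprimeAverage q fun a => G (z a) := by
  have hφ : (q.totient : ENNReal) ≠ 0 := by exact_mod_cast (Nat.totient_pos.2 hq).ne'
  rw [coprimeMeasure, integral_finsetSum_measure fun a _ =>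
    (integrable_dirac enorm_lt_top).smul_measure (ENNReal.inv_ne_top.2 hφ)]
  simp only [integral_smul_measure, integral_dirac, coprimeAverage, ← Finset.smul_sum]
  simp [div_eq_inv_mul]

/-- Weak convergence of the averages over reduced residues may be tested on bounded Lipschitz
functions. -/
theorem tendsto_coprimeAverage_of_forall_lipschitz {z : ℕ → ℕ → ℂ} {F : ℝ → ℂ}
    (hF : Measurable F)
    (hlip : ∀ (G : ℂ → ℝ) (L : NNReal) (M : ℝ), LipschitzWith L G → (∀ w, |G w| ≤ M) →
      Tendsto (fun q => coprimeAverage q fun a => G (z q a)) atTop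
        (𝓝 (∫ x in Set.Icc (0 : ℝ) 1, G (F x))))
    {G : ℂ → ℝ} (hG : Continuous G) {M : ℝ} (hM : ∀ w, |G w| ≤ M) :
    Tendsto (fun q => coprimeAverage q fun a => G (z q a)) atTop
      (𝓝 (∫ x in Set.Icc (0 : ℝ) 1, G (F x))) := by
  have hprob : IsProbabilityMeasure (volume.restrict (Set.Icc (0 : ℝ) 1)) := ⟨by simp⟩
  let ν : ProbabilityMeasure ℂ := ⟨(volume.restrict (Set.Icc (0 : ℝ) 1)).map F,
    Measure.isProbabilityMeasure_map hF.aemeasurable⟩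
  let μ : ℕ → ProbabilityMeasure ℂ := fun n =>
    ⟨coprimeMeasure (n + 1) (z (n + 1)), isProbabilityMeasure_coprimeMeasure n.succ_pos _⟩
  have hν : ∀ {φ : ℂ → ℝ}, Continuous φ →
      ∫ w, φ w ∂(ν : Measure ℂ) = ∫ x in Set.Icc (0 : ℝ) 1, φ (F x) := fun hφ =>
    integral_map hF.aemeasurable hφ.aestronglyMeasurable
  have hμ : ∀ (φ : ℂ → ℝ) n, ∫ w, φ w ∂(μ n : Measure ℂ) =
      coprimeAverage (n + 1) fun a => φ (z (n + 1) a) := fun φ n =>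
    integral_coprimeMeasure n.succ_pos _ _
  have hconv : Tendsto μ atTop (𝓝 ν) := by
    rw [tendsto_iff_forall_lipschitz_integral_tendsto]
    rintro φ ⟨B, hB⟩ ⟨L, hL⟩
    rw [hν hL.continuous]
    simp only [hμ]
    refine (hlip φ L (B + |φ 0|) hL fun w => ?_).comp (tendsto_add_atTop_nat 1)
    have h1 := hB w 0
    rw [Real.dist_eq] at h1
    linarith [abs_sub_abs_le_abs_sub (φ w) (φ 0)]
  have h := ProbabilityMeasure.tendsto_iff_forall_integral_tendsto.1 hconv
    (BoundedContinuousFunction.ofNormedAddCommGroup G hG M hM)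
  simp only [BoundedContinuousFunction.coe_ofNormedAddCommGroup, hν hG, hμ] at h
  exact (tendsto_add_atTop_iff_nat 1).1 h

/-- Equidistribution of the values `q^{-k} f(a/q)`, `(a,q) = 1`, as
`q → ∞`, according to the pushforward of Lebesgue measure under `f‡`, for `Re k > 0`. -/
theorem stmt8 (k : ℂ) (hk : 0 < k.re) (δ : ℝ) (hδ : 0 < δ)
    (f : ℚ → ℂ) (h : ℝ → ℂ)
    (hper : ∀ x : ℚ, x ∉ Set.Icc (-1 : ℚ) 0 → f (x + 1) = f x)
    (hrec : ∀ x : ℚ, x ≠ 0 →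
      f x - ((|((x : ℚ) : ℝ)| : ℝ) : ℂ) ^ (-k) * f (-1 / x) = h x)
    (C : ℝ) (hC : 0 < C)
    (hbound : ∀ x : ℝ, x ∈ Set.Ioo (-1 : ℝ) 1 → x ≠ 0 →
      ‖h x‖ ≤ C * Real.exp (|x| ^ (-1 + δ)))
    (X : Set ℝ) (hXfull : volume Xᶜ = 0)
    (F : ℝ → ℂ) (hFmeas : Measurable F)
    (hFlim : ∀ x ∈ X, Tendsto
      (fun j : ℕ => (((cfConv x (2 * j + 1)).den : ℝ) : ℂ) ^ (-k)
        * f (ratBar (cfConv x (2 * j + 1))))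
      atTop (nhds (F x)))
    (G : ℂ → ℝ) (hG : Continuous G) (M : ℝ) (hGb : ∀ z : ℂ, |G z| ≤ M) :
    Tendsto (fun q : ℕ =>
        (∑ a ∈ (Finset.Icc 1 q).filter fun a => Nat.Coprime a q,
          G (((q : ℝ) : ℂ) ^ (-k) * f ((a : ℚ) / q))) / (q.totient : ℝ))
      atTop (nhds (∫ x in Set.Icc (0 : ℝ) 1, G (F x))) := by
  obtain ⟨δ', hδ0, hδ1, hδle⟩ : ∃ δ' : ℝ, 0 < δ' ∧ δ' < 1 ∧ δ' ≤ δ :=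
    ⟨min δ (1 / 2), by positivity, (min_le_right _ _).trans_lt (by norm_num), min_le_left _ _⟩
  have hbound' : ∀ x : ℝ, x ∈ Set.Ioo (-1 : ℝ) 1 → x ≠ 0 →
      ‖h x‖ ≤ C * Real.exp (|x| ^ (-1 + δ')) := by
    intro x hx hx0
    refine (hbound x hx hx0).trans ?_
    have := Real.rpow_le_rpow_of_exponent_ge (abs_pos.2 hx0) (abs_lt.2 hx).le
      (by linarith : -1 + δ' ≤ -1 + δ)
    gcongr
  exact tendsto_coprimeAverage_of_forall_lipschitz hFmeas
    (fun G L M hL hM => tendsto_coprimeAverage_of_lipschitz hk hper hrec hδ0 hδ1 hC.le hbound'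
      hXfull hFlim hL hM) hG hGb
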